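/- Let m ≥ 1 and a ≥ 1, and let a_{m+1},…,a_n be the level-m expansion of a. For each l, let t_l be the position of the first nonzero base-l digit of a_l (so t_l = ord_l(a_l)+1), and, if a_l has at least two nonzero base-l digits, let u_l be the position of the second nonzero base-l digit. Then C(π^(m+1)(1, χ^(m+1)(a))) = 1 if and only if for every l with m+1 ≤ l ≤ n one has maxdigit_l(a_l) ≤ 1 and, whenever u_l exists, (ι_l(t_l), ι_l(u_l)) ∉ 𝒮_{l+1}. For m = 1, this condition is moreover equivalent to a lying in the image of ι_1. -/

import Mathlib

open List Filter

open scoped Classical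

noncomputable section

/-- The curling number of a finite string: the largest `k` such that
`S = X ++ Y^k` with `Y` nonempty; by convention `curl [] = 1`. -/
def curl (S : List ℕ) : ℕ :=
  max 1 (sSup {k | ∃ X Y : List ℕ, Y ≠ [] ∧ S = X ++ (List.replicate k Y).flatten})

/-- The prefix of length `n` of the level-`m` Gijswijt sequence `A^(m)`. -/
def gPrefix (m : ℕ) : ℕ → List ℕ
  | 0 => []
  | n + 1 => gPrefix m n ++ [max m (curl (gPrefix m n))]

/-- `gij m p` is the `p`-th term (1-indexed) of the level-`m` Gijswijt sequence `A^(m)`. -/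
def gij (m p : ℕ) : ℕ := max m (curl (gPrefix m (p - 1)))

/-- Standing hypothesis: for every `m ≥ 1`, the sets
`{k ≥ 0 : C(A^(m)[1,k]) ≤ m}` and `{k ≥ 0 : C(A^(m+1)[1,k]) ≤ m}` are infinite. -/
def StandingHyp : Prop :=
  ∀ m : ℕ, 1 ≤ m →
    {k : ℕ | curl (gPrefix m k) ≤ m}.Infinite ∧
    {k : ℕ | curl (gPrefix (m + 1) k) ≤ m}.Infinite

/-- Length of `π^(m)(1,x)`: the `x`-th smallest (0-indexed) element of
`{k : C(A^(m)[1,k]) ≤ m}`. -/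
def piLen (m x : ℕ) : ℕ := Nat.nth (fun k => curl (gPrefix m k) ≤ m) x

/-- `π^(m)(1,x)`: the prefix of `A^(m)` with exactly `x` occurrences of `m`
and curling number at most `m`. -/
def piStr (m x : ℕ) : List ℕ := gPrefix m (piLen m x)

/-- `β^(m)(t)`, the length of `B_t^(m)`. -/
def beta (m t : ℕ) : ℕ := piLen m ((m + 1) ^ (t - 1))

/-- `B_t^(m) := π^(m)(1,(m+1)^(t-1))`. -/
def Bstr (m t : ℕ) : List ℕ := piStr m ((m + 1) ^ (t - 1))

/-- `τ^(m)(t)`, the length of `T_t^(m)`. -/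
def tau (m t : ℕ) : ℕ := Nat.nth (fun k => curl (gPrefix (m + 1) k) ≤ m) (t - 1)

/-- `T_t^(m)`: the `t`-th shortest prefix of `A^(m+1)` with curling number at most `m`. -/
def Tstr (m t : ℕ) : List ℕ := gPrefix (m + 1) (tau m t)

/-- `φ^(m)(n)`: the least `p ≥ 1` with `A^(m)(p) = n`. -/
def phi (m n : ℕ) : ℕ := sInf {p : ℕ | 1 ≤ p ∧ gij m p = n}

/-- `t^(m)(n) = 1 + log_{m+1} #\{i ≤ φ^(m)(n) : A^(m)(i) = m\}`. -/
def tfun (m n : ℕ) : ℕ := 1 + Nat.log (m + 1) ((gPrefix m (phi m n)).count m)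

/-- `χ^(b)(a)`: read the base-`b` digits of `a` as base-`(b+1)` digits. -/
def chi (b a : ℕ) : ℕ := Nat.ofDigits (b + 1) (Nat.digits b a)

/-- `ι_m(t)`: read the base-`(m+2)` digits of the number of occurrences of `m+1`
in `T_t^(m)` as base-`(m+1)` digits. -/
def iota (m t : ℕ) : ℕ :=
  Nat.ofDigits (m + 1) (Nat.digits (m + 2) ((Tstr m t).count (m + 1)))

/-- `ι_m⁻¹(p)`: the largest `x ≥ 1` with `ι_m(x) ≤ p`. -/
def iotaInv (m p : ℕ) : ℕ := sSup {x : ℕ | 1 ≤ x ∧ iota m x ≤ p}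

/-- `ord_b(n)`: the `b`-adic valuation of `n`. -/
def ordb (b n : ℕ) : ℕ := sSup {z : ℕ | b ^ z ∣ n}

/-- The largest base-`b` digit of `n`. -/
def maxdigit (b n : ℕ) : ℕ := (Nat.digits b n).foldr max 0

/-- Auxiliary function for the level-`m` expansion: `lexpAux m a k = a_{m+1+k}`. -/
def lexpAux (m a : ℕ) : ℕ → ℕ
  | 0 => a
  | k + 1 => iota (m + 1 + k) (ordb (m + 1 + k) (lexpAux m a k) + 1)

/-- `lexp m a l = a_l`, the `l`-th term of the level-`m` expansion of `a`. -/
def lexp (m a l : ℕ) : ℕ := lexpAux m a (l - (m + 1))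

/-- The last element `n` of `π^(m+1)(1, χ^(m+1)(a))`; the level-`m` expansion
of `a` is `a_{m+1}, …, a_n`. -/
def levelEnd (m a : ℕ) : ℕ := (piStr (m + 1) (chi (m + 1) a)).getLastD 0

/-- `V_m := {v ≥ 0 : C(T_{v+1}^(m+1)) ≤ m}`. -/
def Vset (m : ℕ) : Set ℕ := {v | curl (Tstr (m + 1) (v + 1)) ≤ m}

/-- `Q := {α ≥ 0 : C(T_{α+1}^(2)) = 1}`. -/
def Qset : Set ℕ := {a | curl (Tstr 2 (a + 1)) = 1}

/-- `R := {(a,b) : a ∈ Q, a < b, no suffix S of T_{a+1}^(2) with T_{a+1}^(2)·S = T_{b+1}^(2)}`. -/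
def Rset : Set (ℕ × ℕ) :=
  {p | p.1 ∈ Qset ∧ p.1 < p.2 ∧
    ¬∃ S : List ℕ, S <:+ Tstr 2 (p.1 + 1) ∧ Tstr 2 (p.1 + 1) ++ S = Tstr 2 (p.2 + 1)}

/-- The digit of `x` in base `b` at (1-indexed) position `i`, i.e. the coefficient
of `b^(i-1)`. -/
def digitAt (b x i : ℕ) : ℕ := (Nat.digits b x).getD (i - 1) 0

/-- `u` is the (1-indexed) position of the second nonzero base-`b` digit of `x`
(the first nonzero digit being at position `ord_b(x)+1`). -/
def IsSecondNonzero (b x u : ℕ) : Prop :=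
  ordb b x + 1 < u ∧ digitAt b x u ≠ 0 ∧
    ∀ i, ordb b x + 1 < i → i < u → digitAt b x i = 0

/-- `𝒮_b`: pairs `(a,a')` with `1 ≤ a < a'` such that for some position `y` the
base-`b` digits of `a` and `a'` agree away from `y` and twice the `y`-th digit of `a`
is at least the `y`-th digit of `a'`. -/
def Sset (b : ℕ) : Set (ℕ × ℕ) :=
  {p | 1 ≤ p.1 ∧ p.1 < p.2 ∧
    ∃ y : ℕ, (∀ i, i ≠ y → (Nat.digits b p.1).getD i 0 = (Nat.digits b p.2).getD i 0) ∧
      (Nat.digits b p.2).getD y 0 ≤ 2 * (Nat.digits b p.1).getD y 0}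

/-- The glue string `S_t^(m)`, so that `T_{t+1}^(m) = T_t^(m) ++ glue m t`. -/
def glue (m t : ℕ) : List ℕ := (gPrefix (m + 1) (tau m (t + 1))).drop (tau m t)

/-- The strings `P_t^(m)`: `P_1^(m) = (m)` and `P_{t+1}^(m) = P_t^(m)·B_t^(m)·S_t^(m)`. -/
def Pstr (m : ℕ) : ℕ → List ℕ
  | 0 => []
  | 1 => [m]
  | t + 2 => Pstr m (t + 1) ++ Bstr m (t + 1) ++ glue m (t + 1)

end

/-! ### Curling numbers -/

lemma curl_set_bddAbove (S : List ℕ) :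
    BddAbove {k | ∃ X Y : List ℕ, Y ≠ [] ∧ S = X ++ (List.replicate k Y).flatten} := by
  refine ⟨S.length, ?_⟩
  rintro k ⟨X, Y, hY, rfl⟩
  have := List.length_pos_iff.2 hY
  simp only [List.length_append, List.length_flatten, List.map_replicate, List.sum_replicate,
    smul_eq_mul]
  nlinarith

lemma one_le_curl (S : List ℕ) : 1 ≤ curl S := le_max_left _ _

lemma le_curl {S X Y : List ℕ} {k : ℕ} (hY : Y ≠ [])
    (h : S = X ++ (List.replicate k Y).flatten) : k ≤ curl S :=
  le_max_of_le_right (le_csSup (curl_set_bddAbove S) ⟨X, Y, hY, h⟩)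

lemma curl_le_iff {S : List ℕ} {c : ℕ} (hc : 1 ≤ c) :
    curl S ≤ c ↔ ∀ X Y k, Y ≠ [] → S = X ++ (List.replicate k Y).flatten → k ≤ c := by
  refine ⟨fun h X Y k hY hS => (le_curl hY hS).trans h, fun h => max_le hc ?_⟩
  refine csSup_le ⟨0, S, [0], by simp⟩ ?_
  rintro k ⟨X, Y, hY, hS⟩
  exact h X Y k hY hS

lemma curl_nil : curl [] = 1 := by
  refine le_antisymm ((curl_le_iff le_rfl).2 ?_) (one_le_curl _)
  intro X Y k hY h
  rcases k with _ | k
  · simp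
  · simp [List.replicate_succ, hY] at h

lemma curl_le_of_suffix {P S : List ℕ} (h : P <:+ S) : curl P ≤ curl S := by
  rw [curl_le_iff (one_le_curl _)]
  rintro X Y k hY rfl
  obtain ⟨W, rfl⟩ := h
  exact le_curl (X := W ++ X) hY (by simp)

lemma curl_le_one_iff {S : List ℕ} :
    curl S ≤ 1 ↔ ∀ Y, Y ≠ [] → ¬ (Y ++ Y <:+ S) := by
  rw [curl_le_iff le_rfl]
  constructor
  · rintro h Y hY ⟨X, hX⟩
    have := h X Y 2 hY (by simp [← hX, List.replicate_succ])
    omega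
  · intro h X Y k hY hS
    by_contra! hk
    obtain ⟨k, rfl⟩ := Nat.exists_eq_add_of_le' hk
    refine h Y hY ⟨X ++ (List.replicate k Y).flatten, ?_⟩
    rw [hS, List.replicate_add]
    simp [List.replicate_succ]

/-! ### Strings cut into blocks by a separator -/

/-- The string `F 0, m, F 1, m, …, m, F n`. -/
def blockJoin (m : ℕ) (F : ℕ → List ℕ) : ℕ → List ℕ
  | 0 => F 0
  | n + 1 => blockJoin m F n ++ m :: F (n + 1)

lemma splitOn_blockJoin {m : ℕ} {F : ℕ → List ℕ} (n : ℕ) (hF : ∀ i ≤ n, m ∉ F i) :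
    (blockJoin m F n).splitOn m = (List.range (n + 1)).map F := by
  induction n with
  | zero => simp [blockJoin, List.splitOn_eq_singleton (hF 0 le_rfl)]
  | succ n ih =>
    rw [blockJoin, List.splitOn_append_cons_self, ih fun i hi => hF i (by omega),
      List.splitOn_eq_singleton (hF _ le_rfl), List.range_succ (n := n + 1)]
    simp

lemma length_splitOn (m : ℕ) (L : List ℕ) : (L.splitOn m).length = L.count m + 1 := by
  induction L with
  | nil => simp
  | cons x L ih =>
    rw [List.splitOn_cons_eq_if_modifyHead]
    by_cases h : x = m
    · simp [h, ih]
    · simp [h, ih]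

lemma exists_last_block {m : ℕ} {L : List ℕ} (h : m ∈ L) :
    ∃ A B, L = A ++ m :: B ∧ m ∉ B := by
  obtain ⟨as, bs, h1, h2⟩ := List.eq_append_cons_of_mem (List.mem_reverse.2 h)
  refine ⟨bs.reverse, as.reverse, ?_, by simpa using h2⟩
  have := congrArg List.reverse h1
  simpa using this

lemma splitOn_append_of_notMem {m : ℕ} (L : List ℕ) :
    ∃ D P, L.splitOn m = D ++ [P] ∧ P <:+ L ∧
      ∀ Z, m ∉ Z → (L ++ Z).splitOn m = D ++ [P ++ Z] := by
  by_cases h : m ∈ L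
  · obtain ⟨A, B, rfl, hB⟩ := exists_last_block h
    refine ⟨A.splitOn m, B, ?_, ⟨A ++ [m], by simp⟩, fun Z hZ => ?_⟩
    · rw [List.splitOn_append_cons_self, List.splitOn_eq_singleton hB]
    · rw [List.append_assoc, List.cons_append, List.splitOn_append_cons_self,
        List.splitOn_eq_singleton (a := m) (xs := B ++ Z) (by simp [hB, hZ])]
  · refine ⟨[], L, by simp [List.splitOn_eq_singleton h], List.suffix_rfl, fun Z hZ => ?_⟩
    rw [List.splitOn_eq_singleton (a := m) (by simp [h, hZ])]
    rfl

lemma flatten_replicate_rotate (Z R : List ℕ) (k : ℕ) :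
    (List.replicate (k + 1) (Z ++ R)).flatten
      = Z ++ (List.replicate k (R ++ Z)).flatten ++ R := by
  induction k with
  | zero => simp
  | succ k ih =>
    rw [List.replicate_succ, List.flatten_cons, ih, List.replicate_succ, List.flatten_cons]
    simp

lemma splitOn_append_replicate (m : ℕ) (A B : List ℕ) (k : ℕ) :
    (A ++ (List.replicate k (m :: B)).flatten).splitOn m
      = A.splitOn m ++ (List.replicate k (B.splitOn m)).flatten := by
  induction k with
  | zero => simp
  | succ k ih =>
    simp only [List.replicate_succ', List.flatten_append, List.flatten_singleton]
    rw [← List.append_assoc, List.splitOn_append_cons_self, ih, List.append_assoc]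

lemma map_range_peel {F : ℕ → List ℕ} {n : ℕ} {L D : List (List ℕ)} {Q : List ℕ}
    (hL : L ≠ []) (h : (List.range (n + 1)).map F = L ++ (D ++ [Q])) :
    D.length + 1 ≤ n ∧ F n = Q ∧
      (∀ j, 1 ≤ j → j < D.length + 1 → F (n - j) = D.getD (D.length - j) []) ∧
      (List.range (n - (D.length + 1) + 1)).map F = L := by
  have hlen := congrArg List.length h
  have hL' := List.length_pos_iff.2 hL
  simp only [List.length_map, List.length_range, List.length_append, List.length_cons,
    List.length_nil] at hlen
  have key : ∀ i ≤ n, some (F i) = (L ++ (D ++ [Q]))[i]? := by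
    intro i hi
    rw [← h, List.getElem?_map, List.getElem?_range (by omega)]
    rfl
  refine ⟨by omega, ?_, fun j h1 h2 => ?_, ?_⟩
  · have := key n le_rfl
    rw [List.getElem?_append_right (by omega), List.getElem?_append_right (by omega)] at this
    rw [show n - L.length - D.length = 0 by omega] at this
    simpa using this
  · have := key (n - j) (by omega)
    rw [List.getElem?_append_right (by omega), List.getElem?_append_left (by omega),
      show n - j - L.length = D.length - j by omega] at this
    rw [List.getD_eq_getElem?_getD, ← this]
    rfl
  · have := congrArg (List.take L.length) h
    rw [List.take_left, ← List.map_take, List.take_range] at this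
    rw [← this]
    congr 2
    omega

lemma map_range_peel_replicate {F : ℕ → List ℕ} {D : List (List ℕ)} {Q : List ℕ} (k : ℕ) :
    ∀ {n : ℕ} {L : List (List ℕ)}, L ≠ [] →
      (List.range (n + 1)).map F = L ++ (List.replicate k (D ++ [Q])).flatten →
      k * (D.length + 1) ≤ n ∧
      (∀ i < k, F (n - i * (D.length + 1)) = Q ∧
        ∀ j, 1 ≤ j → j < D.length + 1 →
          F (n - i * (D.length + 1) - j) = D.getD (D.length - j) []) ∧
      (List.range (n - k * (D.length + 1) + 1)).map F = L := by
  induction k with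
  | zero => intro n L _ h; simpa using h
  | succ k ih =>
    intro n L hL h
    rw [List.replicate_succ', List.flatten_append, List.flatten_singleton,
      ← List.append_assoc] at h
    obtain ⟨h1, h2, h3, h4⟩ := map_range_peel (by simp [hL]) h
    obtain ⟨g1, g2, g3⟩ := ih hL h4
    rw [Nat.succ_mul]
    refine ⟨by omega, ?_, ?_⟩
    · intro i hi
      rcases i with _ | i
      · rw [Nat.zero_mul, Nat.sub_zero]
        exact ⟨h2, h3⟩
      · rw [Nat.succ_mul, Nat.add_comm, Nat.sub_add_eq]
        exact g2 i (by omega)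
    · rw [Nat.add_comm (k * _), Nat.sub_add_eq]
      exact g3

/-- A power at the end of a block string, whose base contains the separator, forces the blocks to
repeat periodically. -/
lemma blockJoin_power {m n k : ℕ} {F : ℕ → List ℕ} {X Y : List ℕ} (hF : ∀ i ≤ n, m ∉ F i)
    (hk : 1 ≤ k) (hY : m ∈ Y)
    (h : blockJoin m F n = X ++ (List.replicate k Y).flatten) :
    ∃ Z R, Y = Z ++ m :: R ∧ m ∉ Z ∧ k * Y.count m ≤ n ∧
      (∀ i, 1 ≤ i → i < k → F (n - i * Y.count m) = F n ++ Z) ∧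
      (∀ i < k, ∀ j, 1 ≤ j → j < Y.count m → F (n - i * Y.count m - j) = F (n - j)) ∧
      Z <:+ F (n - k * Y.count m) := by
  obtain ⟨Z, R, rfl, hZ⟩ := List.eq_append_cons_of_mem hY
  obtain ⟨k, rfl⟩ := Nat.exists_eq_add_of_le' hk
  obtain ⟨D, P, hD, -, hDZ⟩ := splitOn_append_of_notMem (m := m) R
  obtain ⟨E, T, hE, -, hEZ⟩ := splitOn_append_of_notMem (m := m) X
  have hcount : (Z ++ m :: R).count m = D.length + 1 := by
    have := length_splitOn m R
    rw [hD] at this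
    simp only [List.length_append, List.length_cons, List.length_nil] at this
    simp [List.count_eq_zero_of_not_mem hZ]
    omega
  have hs : (List.range (n + 1)).map F
      = (E ++ [T ++ Z] ++ (List.replicate k (D ++ [P ++ Z])).flatten) ++ (D ++ [P]) := by
    rw [← splitOn_blockJoin n hF, h, flatten_replicate_rotate, ← List.append_assoc,
      List.splitOn_append_cons_self, ← List.append_assoc]
    simp only [List.cons_append]
    rw [splitOn_append_replicate, hEZ Z hZ, hDZ Z hZ, hD]
  obtain ⟨h1, h2, h3, h4⟩ := map_range_peel (by simp) hs
  obtain ⟨g1, g2, g3⟩ := map_range_peel_replicate k (by simp) h4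
  have hlast : F (n - (k + 1) * (D.length + 1)) = T ++ Z := by
    have := congrArg (fun l => l.getLast?) g3
    simp only [List.range_succ, List.map_append, List.map_cons, List.map_nil,
      List.getLast?_append, List.getLast?_singleton] at this
    rw [Nat.succ_mul, Nat.add_comm, Nat.sub_add_eq]
    simpa using this
  refine ⟨Z, R, rfl, hZ, ?_, ?_, ?_, ?_⟩
  · rw [hcount, Nat.succ_mul]; omega
  · intro i hi hik
    obtain ⟨i, rfl⟩ := Nat.exists_eq_add_of_le' hi
    rw [hcount, Nat.succ_mul, Nat.add_comm, Nat.sub_add_eq, h2]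
    exact (g2 i (by omega)).1
  · intro i hi j hj hje
    rw [hcount] at hje ⊢
    rw [h3 j hj hje]
    rcases i with _ | i
    · rw [Nat.zero_mul, Nat.sub_zero, h3 j hj hje]
    · rw [Nat.succ_mul, Nat.add_comm, Nat.sub_add_eq]
      exact (g2 i (by omega)).2 j hj hje
  · rw [hcount, hlast]
    exact List.suffix_append _ _

lemma count_blockJoin {m n : ℕ} {F : ℕ → List ℕ} (hF : ∀ i ≤ n, m ∉ F i) :
    (blockJoin m F n).count m = n := by
  have := length_splitOn m (blockJoin m F n)
  rw [splitOn_blockJoin n hF] at this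
  simpa using this.symm


/-- The part `m, F (i+1), …, m, F (i+d)` of a block string. -/
def blockSeg (m : ℕ) (F : ℕ → List ℕ) (i : ℕ) : ℕ → List ℕ
  | 0 => []
  | d + 1 => blockSeg m F i d ++ m :: F (i + d + 1)

lemma blockJoin_add (m : ℕ) (F : ℕ → List ℕ) (i d : ℕ) :
    blockJoin m F (i + d) = blockJoin m F i ++ blockSeg m F i d := by
  induction d with
  | zero => simp [blockSeg]
  | succ d ih => rw [← Nat.add_assoc, blockJoin, ih, blockSeg, List.append_assoc]

lemma blockSeg_congr {m d : ℕ} {F G : ℕ → List ℕ} {i i' : ℕ}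
    (h : ∀ j, 1 ≤ j → j ≤ d → F (i + j) = G (i' + j)) : blockSeg m F i d = blockSeg m G i' d := by
  induction d with
  | zero => rfl
  | succ d ih =>
    rw [blockSeg, blockSeg, ih fun j h1 h2 => h j h1 (by omega), Nat.add_assoc, Nat.add_assoc,
      h (d + 1) (by omega) le_rfl]

lemma blockSeg_ne_nil {m d : ℕ} {F : ℕ → List ℕ} {i : ℕ} (h : 1 ≤ d) : blockSeg m F i d ≠ [] := by
  obtain ⟨d, rfl⟩ := Nat.exists_eq_add_of_le' h
  simp [blockSeg]

lemma blockSeg_eq_cons (m : ℕ) (F : ℕ → List ℕ) (i d : ℕ) :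
    ∃ Q, blockSeg m F i (d + 1) = m :: Q := by
  induction d with
  | zero => exact ⟨F (i + 1), by simp [blockSeg]⟩
  | succ d ih =>
    obtain ⟨Q, hQ⟩ := ih
    exact ⟨_, by rw [blockSeg, hQ, List.cons_append]⟩

lemma blockJoin_eq_of_periodic {m e : ℕ} {F : ℕ → List ℕ} {i₀ : ℕ} {B : List ℕ} (k : ℕ)
    (h : ∀ i < k, blockSeg m F (i₀ + i * e) e = B) :
    blockJoin m F (i₀ + k * e) = blockJoin m F i₀ ++ (List.replicate k B).flatten := by
  induction k with
  | zero => simp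
  | succ k ih =>
    rw [Nat.succ_mul, ← Nat.add_assoc, blockJoin_add, ih fun i hi => h i (by omega),
      h k (by omega), List.replicate_succ', List.flatten_append]
    simp

/-! ### Digits and the ruler sequence -/

/-- The coefficient of `b ^ i` in the base-`b` expansion of `n`. -/
def coeffAt (b n i : ℕ) : ℕ := n / b ^ i % b

lemma coeffAt_eq_mod_div (b n i : ℕ) : coeffAt b n i = n % b ^ (i + 1) / b ^ i := by
  rw [coeffAt, pow_succ, Nat.mod_mul_right_div_self]

lemma coeffAt_lt {b : ℕ} (hb : 2 ≤ b) (n i : ℕ) : coeffAt b n i < b := Nat.mod_lt _ (by omega)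

lemma le_coeffAt_iff {b : ℕ} (hb : 2 ≤ b) (n i c : ℕ) :
    c ≤ coeffAt b n i ↔ c * b ^ i ≤ n % b ^ (i + 1) := by
  rw [coeffAt_eq_mod_div, Nat.le_div_iff_mul_le (by positivity)]

lemma coeffAt_succ (b n i : ℕ) : coeffAt b n (i + 1) = coeffAt b (n / b) i := by
  rw [coeffAt, coeffAt, pow_succ', Nat.div_div_eq_div_mul]

lemma coeffAt_ext {b : ℕ} (hb : 2 ≤ b) :
    ∀ {n n' : ℕ}, (∀ i, coeffAt b n i = coeffAt b n' i) → n = n' := by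
  intro n
  induction n using Nat.strong_induction_on with
  | _ n ih =>
    intro n' h
    have h0 : n % b = n' % b := by simpa [coeffAt] using h 0
    have h1 : ∀ i, coeffAt b (n / b) i = coeffAt b (n' / b) i := fun i => by
      simpa [coeffAt_succ] using h (i + 1)
    rcases Nat.eq_zero_or_pos n with rfl | hn
    · by_contra hne
      have hpos : 0 < n' := by omega
      obtain ⟨i, hi⟩ : ∃ i, coeffAt b n' i ≠ 0 := by
        refine ⟨Nat.log b n', ?_⟩
        have hlt := Nat.lt_pow_succ_log_self (b := b) (by omega) n'
        have hle := Nat.pow_log_le_self b (x := n') (by omega)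
        rw [coeffAt_eq_mod_div, Nat.mod_eq_of_lt hlt]
        exact (Nat.div_pos hle (by positivity)).ne'
      exact hi (by rw [← h i]; simp [coeffAt])
    · have := ih (n / b) (Nat.div_lt_self hn (by omega)) h1
      rw [← Nat.div_add_mod n b, ← Nat.div_add_mod n' b, this, h0]

lemma coeffAt_add {b : ℕ} (hb : 2 ≤ b) {n q c : ℕ} (h : coeffAt b n q + c < b) (i : ℕ) :
    coeffAt b (n + c * b ^ q) i = if i = q then coeffAt b n q + c else coeffAt b n i := by
  rcases lt_trichotomy i q with hi | rfl | hi
  · rw [if_neg hi.ne, coeffAt_eq_mod_div, coeffAt_eq_mod_div,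
      (Nat.modEq_zero_iff_dvd.2 (Dvd.dvd.mul_left (pow_dvd_pow b hi) c)).add_left n]
    simp
  · rw [if_pos rfl, coeffAt, Nat.add_mul_div_right _ _ (by positivity), Nat.add_mod]
    rw [coeffAt] at h
    rw [Nat.mod_eq_of_lt (a := c) (by omega), Nat.mod_eq_of_lt h, coeffAt]
  · rw [if_neg hi.ne']
    obtain ⟨d, rfl⟩ := Nat.exists_eq_add_of_lt hi
    have hp : b ^ (q + d + 1) = b ^ q * b * b ^ d := by ring
    rw [coeffAt, coeffAt, hp, ← Nat.div_div_eq_div_mul, ← Nat.div_div_eq_div_mul,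
      ← Nat.div_div_eq_div_mul, ← Nat.div_div_eq_div_mul,
      Nat.add_mul_div_right _ _ (by positivity)]
    have : (n / b ^ q + c) / b = n / b ^ q / b := by
      rw [coeffAt] at h
      conv_lhs => rw [← Nat.div_add_mod (n / b ^ q) b, Nat.add_assoc]
      rw [Nat.mul_add_div (by omega), Nat.div_eq_of_lt h, Nat.add_zero]
    rw [this]

lemma pow_dvd_iff_coeffAt {b : ℕ} (hb : 2 ≤ b) (n z : ℕ) :
    b ^ z ∣ n ↔ ∀ i < z, coeffAt b n i = 0 := by
  induction z with
  | zero => simp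
  | succ z ih =>
    rw [Nat.forall_lt_succ_right, ← ih]
    constructor
    · intro h
      refine ⟨(pow_dvd_pow b z.le_succ).trans h, ?_⟩
      rw [coeffAt_eq_mod_div, Nat.mod_eq_zero_of_dvd h, Nat.zero_div]
    · rintro ⟨h, h'⟩
      obtain ⟨k, rfl⟩ := h
      rw [coeffAt, Nat.mul_div_cancel_left _ (by positivity)] at h'
      rw [pow_succ]
      exact Nat.mul_dvd_mul_left _ (Nat.dvd_of_mod_eq_zero h')

lemma pow_dvd_iff_le_ordb {b n : ℕ} (hb : 2 ≤ b) (hn : 1 ≤ n) (z : ℕ) :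
    b ^ z ∣ n ↔ z ≤ ordb b n := by
  have hbdd : BddAbove {z : ℕ | b ^ z ∣ n} :=
    ⟨n, fun z hz => (Nat.lt_pow_self (n := z) (a := b) (by omega)).le.trans
      (Nat.le_of_dvd hn hz)⟩
  have hmem : b ^ ordb b n ∣ n := Nat.sSup_mem (s := {z : ℕ | b ^ z ∣ n}) ⟨0, by simp⟩ hbdd
  exact ⟨fun h => le_csSup hbdd h, fun h => (pow_dvd_pow b h).trans hmem⟩

lemma ordb_eq_iff {b n : ℕ} (hb : 2 ≤ b) (hn : 1 ≤ n) (p : ℕ) :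
    ordb b n = p ↔ b ^ p ∣ n ∧ ¬ b ^ (p + 1) ∣ n := by
  rw [pow_dvd_iff_le_ordb hb hn, pow_dvd_iff_le_ordb hb hn]
  omega

lemma ordb_eq_ordb {b n n' : ℕ} (hb : 2 ≤ b) (hn : 1 ≤ n) (hn' : 1 ≤ n')
    (h : ∀ z, b ^ z ∣ n ↔ b ^ z ∣ n') : ordb b n = ordb b n' := by
  rw [ordb_eq_iff hb hn, h, h, ← ordb_eq_iff hb hn']

lemma dvd_iff_of_ordb_eq {b n n' : ℕ} (hb : 2 ≤ b) (hn : 1 ≤ n) (hn' : 1 ≤ n')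
    (h : ordb b n = ordb b n') (z : ℕ) : b ^ z ∣ n ↔ b ^ z ∣ n' := by
  rw [pow_dvd_iff_le_ordb hb hn, pow_dvd_iff_le_ordb hb hn', h]

lemma ordb_add_eq {b n d Q : ℕ} (hb : 2 ≤ b) (hd : ∀ z < Q, b ^ z ∣ d)
    (hn : ¬ b ^ Q ∣ n) (hn' : ¬ b ^ Q ∣ n + d) : ordb b (n + d) = ordb b n := by
  have h1 : 1 ≤ n := Nat.one_le_iff_ne_zero.2 fun h => hn (by simp [h])
  refine ordb_eq_ordb hb (by omega) h1 fun z => ?_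
  rcases lt_or_ge z Q with hz | hz
  · exact (Nat.dvd_add_iff_left (hd z hz)).symm
  · exact iff_of_false (fun h => hn' ((pow_dvd_pow b hz).trans h))
      fun h => hn ((pow_dvd_pow b hz).trans h)

lemma not_dvd_sub_of_lt_mod {N n j : ℕ} (h : j < n % N) : ¬ N ∣ n - j := by
  intro hd
  have hN : 0 < N := by
    rcases Nat.eq_zero_or_pos N with rfl | h'
    · simp only [Nat.mod_zero] at h
      have := Nat.eq_zero_of_zero_dvd hd
      omega
    · exact h'
  have hlt := Nat.mod_lt n hN
  have hsplit : n - j = N * (n / N) + (n % N - j) := by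
    have := Nat.div_add_mod n N
    omega
  rw [hsplit, ← Nat.dvd_add_iff_right (Dvd.intro _ rfl)] at hd
  have := Nat.le_of_dvd (by omega) hd
  omega

lemma ordb_window {b n k c q : ℕ} (hb : 2 ≤ b) (h : k * (c * b ^ q) ≤ n % b ^ (q + 1)) {i j : ℕ}
    (hi : i < k) (hj : 1 ≤ j) (hj' : j ≤ c * b ^ q) :
    ordb b (n - k * (c * b ^ q) + i * (c * b ^ q) + j)
      = ordb b (n - k * (c * b ^ q) + j) := by
  have hik : (i + 1) * (c * b ^ q) ≤ k * (c * b ^ q) := Nat.mul_le_mul_right _ hi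
  have hk1 : 1 * (c * b ^ q) ≤ k * (c * b ^ q) := Nat.mul_le_mul_right _ (by omega)
  have hmod := Nat.mod_le n (b ^ (q + 1))
  rw [Nat.add_right_comm]
  generalize hE : k * (c * b ^ q) = E at *
  refine ordb_add_eq (Q := q + 1) hb (fun z hz => ?_) ?_ ?_
  · exact Dvd.dvd.mul_left (Dvd.dvd.mul_left (pow_dvd_pow b (by omega)) c) i
  · rw [show n - E + j = n - (E - j) by omega]
    exact not_dvd_sub_of_lt_mod (by omega)
  · rw [Nat.succ_mul] at hik
    rw [show n - E + j + i * (c * b ^ q) = n - (E - j - i * (c * b ^ q)) by omega]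
    exact not_dvd_sub_of_lt_mod (by omega)

section RulerPeriod

variable {b x e k : ℕ}

/-- In a window where the ruler sequence has period `e` away from the positions `x - i * e`, the
multiples of `b ^ (ordb b e + 1)` are among those positions. -/
lemma multiple_in_window (hb : 2 ≤ b) (he : 1 ≤ e) (hk : 2 ≤ k) (hx : k * e ≤ x)
    (hper : ∀ i < k, ∀ j, 1 ≤ j → j < e → ordb b (x - i * e - j) = ordb b (x - j))
    {y : ℕ} (hy : x - k * e < y) (hyx : y ≤ x) (hd : b ^ (ordb b e + 1) ∣ y) :
    ∃ i < k, y = x - i * e := by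
  have hsplit := Nat.div_add_mod (x - y) e
  have hmod := Nat.mod_lt (x - y) he
  have hik : (x - y) / e < k := (Nat.div_lt_iff_lt_mul he).2 (by omega)
  refine ⟨(x - y) / e, hik, ?_⟩
  rw [Nat.mul_comm] at hsplit
  rcases Nat.eq_zero_or_pos ((x - y) % e) with h0 | hpos
  · omega
  exfalso
  have h2k : 2 * e ≤ k * e := Nat.mul_le_mul_right _ hk
  have e1 := hper _ hik _ hpos hmod
  have e2 := hper 1 (by omega) _ hpos hmod
  rw [Nat.one_mul] at e2
  have hy' : y = x - (x - y) / e * e - (x - y) % e := by omega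
  rw [← hy'] at e1
  have d1 := (dvd_iff_of_ordb_eq hb (by omega) (by omega) e1 _).1 hd
  have d2 := (dvd_iff_of_ordb_eq hb (by omega) (by omega) e2 _).2 d1
  have d3 := Nat.dvd_sub d1 d2
  rw [show x - (x - y) % e - (x - e - (x - y) % e) = e by omega,
    pow_dvd_iff_le_ordb hb he] at d3
  omega

lemma not_dvd_both (hb : 2 ≤ b) (he : 1 ≤ e) {y : ℕ} (hy : e ≤ y)
    (h1 : b ^ (ordb b e + 1) ∣ y) (h2 : b ^ (ordb b e + 1) ∣ y - e) : False := by
  have h := Nat.dvd_sub h1 h2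
  rw [Nat.sub_sub_self hy, pow_dvd_iff_le_ordb hb he] at h
  omega

lemma pow_ordb_le (hb : 2 ≤ b) (he : 1 ≤ e) : b ^ ordb b e ≤ e :=
  Nat.le_of_dvd he ((pow_dvd_iff_le_ordb hb he _).2 le_rfl)

lemma exists_multiple_in_window {N : ℕ} (hx : k * e ≤ x) (h : x % N < k * e) :
    ∃ y, x - k * e < y ∧ y ≤ x ∧ N ∣ y :=
  ⟨x - x % N, by omega, by omega, Nat.dvd_sub_mod x⟩

/-- Bound on the exponent of a power at the end of an initial part of the ruler sequence, whose
last term is left free. -/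
lemma ruler_power_bound (hb : 2 ≤ b) (he : 1 ≤ e) (hk : b ≤ k) (hx : k * e ≤ x)
    (hper : ∀ i < k, ∀ j, 1 ≤ j → j < e → ordb b (x - i * e - j) = ordb b (x - j))
    (heq : ∀ i, 1 ≤ i → i < k → ordb b (x - i * e) = ordb b (x - e)) :
    k = b ∧ (ordb b (x - e) < ordb b x ∨ k = 2 ∧ ordb b x = ordb b e) := by
  have hk2 : 2 ≤ k := hb.trans hk
  have h2k : 2 * e ≤ k * e := Nat.mul_le_mul_right _ hk2
  have hpe : b ^ (ordb b e + 1) ≤ b * e := by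
    rw [pow_succ']; exact Nat.mul_le_mul_left _ (pow_ordb_le hb he)
  have hbk : b * e ≤ k * e := Nat.mul_le_mul_right _ hk
  have hpos : 0 < b ^ (ordb b e + 1) := by positivity
  have hfirst : 3 ≤ k → ∀ i, 1 ≤ i → i < k → ¬ b ^ (ordb b e + 1) ∣ x - i * e := by
    intro hk3 i hi hik hd
    have h3k : 3 * e ≤ k * e := Nat.mul_le_mul_right _ hk3
    have hik' : (i + 1) * e ≤ k * e := Nat.mul_le_mul_right _ hik
    rw [Nat.succ_mul] at hik'
    have d1 := (dvd_iff_of_ordb_eq hb (by omega) (by omega) (heq i hi hik) _).1 hd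
    have d2 := (dvd_iff_of_ordb_eq hb (by omega) (by omega)
      (heq 2 (by omega) (by omega)) _).2 d1
    exact not_dvd_both hb he (by omega) d1 (by rwa [show x - e - e = x - 2 * e by omega])
  obtain ⟨y, hy, hyx, hd⟩ := exists_multiple_in_window (N := b ^ (ordb b e + 1)) hx
    ((Nat.mod_lt _ hpos).trans_le (hpe.trans hbk))
  obtain ⟨i, hik, rfl⟩ := multiple_in_window hb he hk2 hx hper hy hyx hd
  have hxdvd : b ^ (ordb b e + 1) ∣ x → ordb b (x - e) < ordb b x := by
    intro h
    by_contra! hle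
    rw [pow_dvd_iff_le_ordb hb (by omega)] at h
    exact not_dvd_both hb he (by omega) ((pow_dvd_iff_le_ordb hb (by omega) _).2 h)
      ((pow_dvd_iff_le_ordb hb (by omega) _).2 (h.trans hle))
  rcases Nat.lt_or_ge k 3 with hk3 | hk3
  · have hk' : k = 2 := by omega
    subst hk'
    refine ⟨by omega, ?_⟩
    by_cases hxd : b ^ (ordb b e + 1) ∣ x
    · exact Or.inl (hxdvd hxd)
    · refine Or.inr ⟨rfl, ?_⟩
      obtain rfl : i = 1 := by
        rcases i with _ | i
        · simp at hd; exact absurd hd hxd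
        · omega
      rw [Nat.one_mul] at hd
      rw [ordb_eq_iff hb (by omega)]
      refine ⟨?_, hxd⟩
      have := Nat.dvd_add ((pow_dvd_pow b (Nat.le_succ (ordb b e))).trans hd)
        ((pow_dvd_iff_le_ordb hb he _).2 le_rfl)
      rwa [Nat.sub_add_cancel (by omega)] at this
  · have hi0 : i = 0 := by
      by_contra hi
      exact hfirst hk3 i (by omega) hik hd
    subst hi0
    rw [Nat.zero_mul, Nat.sub_zero] at hd
    refine ⟨?_, Or.inl (hxdvd hd)⟩
    by_contra hne
    have hlt : (b + 1) * e ≤ k * e := Nat.mul_le_mul_right _ (by omega)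
    rw [Nat.succ_mul] at hlt
    have hd' : b ^ (ordb b e + 1) ∣ x - b ^ (ordb b e + 1) := Nat.dvd_sub hd dvd_rfl
    obtain ⟨i, hik, hi⟩ := multiple_in_window hb he hk2 hx hper (by omega) (by omega) hd'
    rcases i with _ | i
    · omega
    · exact hfirst hk3 (i + 1) (by omega) hik (hi ▸ hd')

/-- A square at the end of an initial part of the ruler sequence. -/
lemma ruler_square (hb : 2 ≤ b) (he : 1 ≤ e) (hx : 2 * e ≤ x)
    (hper : ∀ j < e, ordb b (x - e - j) = ordb b (x - j)) :
    ∃ q c, 1 ≤ c ∧ e = c * b ^ q ∧ 2 * (c * b ^ q) ≤ x % b ^ (q + 1) := by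
  obtain ⟨c, hc⟩ := (pow_dvd_iff_le_ordb hb he _).2 le_rfl
  have hce : c * b ^ ordb b e = e := by rw [Nat.mul_comm, ← hc]
  refine ⟨ordb b e, c, ?_, hce.symm, ?_⟩
  · rcases c with _ | c
    · simp at hc; omega
    · omega
  · rw [hce]
    by_contra! hlt
    obtain ⟨y, hy, hyx, hd⟩ := exists_multiple_in_window hx hlt
    obtain ⟨i, hi, rfl⟩ := multiple_in_window hb he le_rfl hx (fun i hi j _ hj => by
      rcases (by omega : i = 0 ∨ i = 1) with rfl | rfl
      · simp
      · simpa using hper j hj) hy hyx hd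
    have h0 : ordb b (x - e) = ordb b x := by simpa using hper 0 he
    have h1 := dvd_iff_of_ordb_eq hb (by omega) (by omega) h0 (ordb b e + 1)
    rcases (by omega : i = 0 ∨ i = 1) with rfl | rfl
    · rw [Nat.zero_mul, Nat.sub_zero] at hd
      exact not_dvd_both hb he (by omega) hd (h1.2 hd)
    · rw [Nat.one_mul] at hd
      exact not_dvd_both hb he (by omega) (h1.1 hd) hd

end RulerPeriod

/-! ### Gijswijt sequences and their block structure -/

lemma length_gPrefix (m n : ℕ) : (gPrefix m n).length = n := by
  induction n with
  | zero => rfl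
  | succ n ih => simp [gPrefix, ih]

lemma le_of_mem_gPrefix {m n x : ℕ} (h : x ∈ gPrefix m n) : m ≤ x := by
  induction n with
  | zero => simp [gPrefix] at h
  | succ n ih =>
    rcases List.mem_append.1 h with h | h
    · exact ih h
    · rw [List.mem_singleton.1 h]
      exact le_max_left _ _

lemma notMem_gPrefix_succ (m n : ℕ) : m ∉ gPrefix (m + 1) n := fun h => by
  have := le_of_mem_gPrefix h
  omega

lemma curl_Tstr_le {m : ℕ} (H : {k : ℕ | curl (gPrefix (m + 1) k) ≤ m}.Infinite)
    (t : ℕ) : curl (Tstr m t) ≤ m :=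
  Nat.nth_mem_of_infinite (p := fun k => curl (gPrefix (m + 1) k) ≤ m) H (t - 1)

lemma tau_lt_tau {m : ℕ} (H : {k : ℕ | curl (gPrefix (m + 1) k) ≤ m}.Infinite)
    {t u : ℕ} (h : t < u) : tau m (t + 1) < tau m (u + 1) :=
  Nat.nth_strictMono (p := fun k => curl (gPrefix (m + 1) k) ≤ m) H (by simpa using h)

lemma tau_injective {m : ℕ} (H : {k : ℕ | curl (gPrefix (m + 1) k) ≤ m}.Infinite)
    {t u : ℕ} (h : tau m (t + 1) = tau m (u + 1)) : t = u := by
  rcases lt_trichotomy t u with h' | h' | h'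
  · exact absurd h (tau_lt_tau H h').ne
  · exact h'
  · exact absurd h (tau_lt_tau H h').ne'

lemma lt_of_tau_lt {m : ℕ} (H : {k : ℕ | curl (gPrefix (m + 1) k) ≤ m}.Infinite)
    {t u : ℕ} (h : tau m (t + 1) < tau m (u + 1)) : t < u := by
  by_contra! hle
  rcases hle.lt_or_eq with h' | rfl
  · exact absurd h (tau_lt_tau H h').not_gt
  · exact absurd h (lt_irrefl _)

lemma Tstr_injective {m : ℕ} (H : {k : ℕ | curl (gPrefix (m + 1) k) ≤ m}.Infinite)
    {t u : ℕ} (h : Tstr m (t + 1) = Tstr m (u + 1)) : t = u :=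
  tau_injective H (by simpa [Tstr, length_gPrefix] using congrArg List.length h)

lemma exists_tau_eq {m : ℕ} (H : {k : ℕ | curl (gPrefix (m + 1) k) ≤ m}.Infinite)
    {s : ℕ} (hs : curl (gPrefix (m + 1) s) ≤ m) : ∃ t, tau m (t + 1) = s := by
  have := Nat.range_nth_of_infinite (p := fun k => curl (gPrefix (m + 1) k) ≤ m) H
  obtain ⟨t, ht⟩ : s ∈ Set.range (Nat.nth fun k => curl (gPrefix (m + 1) k) ≤ m) := by
    rw [this]; exact hs
  exact ⟨t, ht⟩

/-- The blocks following the occurrences of `m` in `A^(m)`. -/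
noncomputable def rulerBlock (m i : ℕ) : List ℕ :=
  if i = 0 then [] else Tstr m (ordb (m + 1) i + 1)

lemma rulerBlock_of_pos {m i : ℕ} (hi : 1 ≤ i) :
    rulerBlock m i = Tstr m (ordb (m + 1) i + 1) := if_neg (by omega)

lemma notMem_rulerBlock (m i : ℕ) : m ∉ rulerBlock m i := by
  unfold rulerBlock
  split
  · simp
  · exact notMem_gPrefix_succ _ _

lemma blockJoin_congr {m n : ℕ} {F G : ℕ → List ℕ} (h : ∀ i ≤ n, F i = G i) :
    blockJoin m F n = blockJoin m G n := by
  induction n with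
  | zero => exact h 0 le_rfl
  | succ n ih => rw [blockJoin, blockJoin, ih fun i hi => h i (by omega), h _ le_rfl]

lemma blockJoin_update (m : ℕ) (F : ℕ → List ℕ) (n : ℕ) (P : List ℕ) :
    blockJoin m (Function.update F (n + 1) P) (n + 1) = blockJoin m F n ++ m :: P := by
  rw [blockJoin, Function.update_self,
    blockJoin_congr (G := F) fun i hi => Function.update_of_ne (by omega) _ _]

lemma suffix_of_notMem {m : ℕ} {W P X B : List ℕ} (hB : m ∉ B) (h : W ++ m :: P = X ++ B) :
    B <:+ P := by
  rcases List.suffix_or_suffix_of_suffix (List.suffix_append W (m :: P))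
    (h ▸ List.suffix_append X B) with h' | h'
  · exact absurd (h'.subset (by simp)) hB
  · rcases List.suffix_cons_iff.1 h' with rfl | h'
    · simp at hB
    · exact h'

lemma min_ordb_add {b q y i : ℕ} (hb : 2 ≤ b) (hy : 1 ≤ y) :
    min (ordb b (y + i * b ^ q)) q = min (ordb b y) q := by
  refine eq_of_forall_le_iff fun z => ?_
  rw [le_min_iff, le_min_iff, ← pow_dvd_iff_le_ordb hb hy, ← pow_dvd_iff_le_ordb hb (by omega)]
  refine and_congr_left fun hz => ?_
  exact (Nat.dvd_add_iff_left (Dvd.dvd.mul_left (pow_dvd_pow b hz) i)).symm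

section Structure

variable {m : ℕ}

lemma rulerBlock_power_le (hm : 1 ≤ m) (H : {k : ℕ | curl (gPrefix (m + 1) k) ≤ m}.Infinite)
    {n s k : ℕ} {X Y : List ℕ} (hmem : m ∈ Y)
    (h : blockJoin m (rulerBlock m) n ++ m :: gPrefix (m + 1) s
      = X ++ (List.replicate k Y).flatten) :
    k ≤ m + 1 ∧ (s = tau m (ordb (m + 1) (n + 1) + 1) → k ≤ m) := by
  rcases Nat.lt_or_ge k (m + 1) with hk | hk
  · omega
  have hb : 2 ≤ m + 1 := by omega
  rw [← blockJoin_update] at h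
  set P := gPrefix (m + 1) s with hP
  set x := n + 1 with hx
  have hF : ∀ i ≤ x, m ∉ Function.update (rulerBlock m) x P i := by
    intro i _
    by_cases hi : i = x
    · rw [hi, Function.update_self]; exact notMem_gPrefix_succ _ _
    · rw [Function.update_of_ne hi]; exact notMem_rulerBlock _ _
  obtain ⟨Z, R, rfl, hZ, hke, heq, hper, hsuf⟩ := blockJoin_power hF (by omega) hmem h
  have he : 1 ≤ (Z ++ m :: R).count m := List.count_pos_iff.2 hmem
  generalize (Z ++ m :: R).count m = e at *
  have hblock : ∀ y, 1 ≤ y → y < x → Function.update (rulerBlock m) x P y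
      = Tstr m (ordb (m + 1) y + 1) := fun y h1 h2 => by
    rw [Function.update_of_ne (by omega), rulerBlock_of_pos h1]
  have hle : ∀ i < k, i * e + e ≤ k * e := fun i hi => by
    rw [← Nat.succ_mul]; exact Nat.mul_le_mul_right _ hi
  have hper' : ∀ i < k, ∀ j, 1 ≤ j → j < e →
      ordb (m + 1) (x - i * e - j) = ordb (m + 1) (x - j) := by
    intro i hi j hj hje
    have := hle i hi
    have := hper i hi j hj hje
    rw [hblock _ (by omega) (by omega), hblock _ (by omega) (by omega)] at this
    exact Tstr_injective H this
  rw [Function.update_self] at heq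
  have heq1 : ∀ i, 1 ≤ i → i < k → Tstr m (ordb (m + 1) (x - i * e) + 1) = P ++ Z := by
    intro i hi hik
    have := hle i hik
    have h1 : 1 * e ≤ i * e := Nat.mul_le_mul_right _ hi
    rw [← heq i hi hik, hblock _ (by omega) (by omega)]
  have heq1' := heq1 1 le_rfl (by omega)
  rw [Nat.one_mul] at heq1'
  obtain ⟨hkb, hcase⟩ := ruler_power_bound hb he hk hke hper' fun i hi hik =>
    Tstr_injective H ((heq1 i hi hik).trans heq1'.symm)
  refine ⟨hkb.le, fun hs => ?_⟩
  exfalso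
  have hPT : P = Tstr m (ordb (m + 1) x + 1) := by rw [hP, hs, Tstr]
  rcases hcase with hlt | ⟨rfl, hord⟩
  · have hlen := congrArg List.length heq1'
    rw [Tstr, length_gPrefix, List.length_append, hP, length_gPrefix] at hlen
    have := tau_lt_tau H hlt
    omega
  · obtain rfl : m = 1 := by omega
    have hxe : (1 + 1) ^ ordb (1 + 1) e ∣ x ∧ ¬ (1 + 1) ^ (ordb (1 + 1) e + 1) ∣ x :=
      (ordb_eq_iff hb (by omega) _).1 hord
    have hee : (1 + 1) ^ ordb (1 + 1) e ∣ e := (pow_dvd_iff_le_ordb hb he _).2 le_rfl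
    by_cases hZ0 : Z = []
    · obtain ⟨q, c, hc, -, hle⟩ := ruler_square hb he hke fun j hj => by
        rcases Nat.eq_zero_or_pos j with rfl | hj'
        · have := Tstr_injective H (heq1'.trans (by rw [hZ0, List.append_nil, hPT]))
          simpa using this
        · simpa using hper' 1 (by omega) j hj' hj
      have hlt := Nat.mod_lt x (y := (1 + 1) ^ (q + 1)) (by positivity)
      rw [pow_succ'] at hlt hle
      have : 1 * (1 + 1) ^ q ≤ c * (1 + 1) ^ q := Nat.mul_le_mul_right _ hc
      omega
    · have hx2 : 1 ≤ x - 2 * e := by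
        by_contra! h0
        rw [Nat.lt_one_iff.1 h0, Function.update_of_ne (by omega)] at hsuf
        exact hZ0 (List.suffix_nil.1 hsuf)
      rw [hblock _ hx2 (by omega)] at hsuf
      have hord2 : ordb (1 + 1) (x - 2 * e) = ordb (1 + 1) x := by
        rw [hord, ordb_eq_iff hb hx2]
        refine ⟨Nat.dvd_sub hxe.1 (Dvd.dvd.mul_left hee 2), fun hd => hxe.2 ?_⟩
        have h2e : (1 + 1) ^ (ordb (1 + 1) e + 1) ∣ 2 * e := by
          rw [pow_succ']; exact Nat.mul_dvd_mul_left _ hee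
        have := Nat.dvd_add hd h2e
        rwa [Nat.sub_add_cancel (by omega)] at this
      rw [hord2, ← hPT] at hsuf
      obtain ⟨V, hV⟩ := hsuf
      have hcurl := curl_Tstr_le H (ordb (1 + 1) (x - e) + 1)
      refine curl_le_one_iff.1 hcurl Z hZ0 ⟨V, ?_⟩
      rw [heq1', ← hV, List.append_assoc]

lemma lt_curl_of_lt_tau (hm : 1 ≤ m) (H : {k : ℕ | curl (gPrefix (m + 1) k) ≤ m}.Infinite)
    {n s : ℕ} (hs : s < tau m (ordb (m + 1) (n + 1) + 1)) :
    m + 1 ≤ curl (blockJoin m (rulerBlock m) n ++ m :: gPrefix (m + 1) s) := by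
  rcases Nat.lt_or_ge m (curl (gPrefix (m + 1) s)) with hc | hc
  · exact le_trans (Nat.succ_le_of_lt hc) (curl_le_of_suffix (P := gPrefix (m + 1) s)
      ⟨blockJoin m (rulerBlock m) n ++ [m], by simp⟩)
  have hb : 2 ≤ m + 1 := by omega
  obtain ⟨q, rfl⟩ := exists_tau_eq H hc
  have hq := lt_of_tau_lt H hs
  rw [← blockJoin_update]
  set x := n + 1 with hx
  have hd : (m + 1) ^ (q + 1) ∣ x := (pow_dvd_iff_le_ordb hb (by omega) _).2 hq
  have hpe : (m + 1) ^ (q + 1) = (m + 1) * (m + 1) ^ q := pow_succ' _ _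
  have hpos : 0 < (m + 1) ^ q := by positivity
  have hle := Nat.le_of_dvd (by omega) hd
  set F := Function.update (rulerBlock m) x (gPrefix (m + 1) (tau m (q + 1))) with hFdef
  have hF : ∀ y, x - (m + 1) ^ (q + 1) < y → y ≤ x →
      F y = Tstr m (min (ordb (m + 1) y) q + 1) := by
    intro y h1 h2
    by_cases hy : y = x
    · rw [hy, hFdef, Function.update_self, Nat.min_eq_right (by omega), Tstr]
    · rw [hFdef, Function.update_of_ne hy, rulerBlock_of_pos (by omega), Nat.min_eq_left]
      by_contra! hlt
      have := Nat.dvd_sub hd ((pow_dvd_iff_le_ordb hb (by omega) _).2 hlt)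
      have := Nat.le_of_dvd (by omega) this
      omega
  have hJ := blockJoin_eq_of_periodic (m := m) (e := (m + 1) ^ q) (F := F)
    (i₀ := x - (m + 1) ^ (q + 1)) (B := blockSeg m F (x - (m + 1) ^ (q + 1)) ((m + 1) ^ q))
    (m + 1) (fun i hi => by
      have hi' : (i + 1) * (m + 1) ^ q ≤ (m + 1) * (m + 1) ^ q := Nat.mul_le_mul_right _ hi
      have h1' : 1 * (m + 1) ^ q ≤ (m + 1) * (m + 1) ^ q := Nat.mul_le_mul_right _ (by omega)
      rw [Nat.succ_mul] at hi'
      refine blockSeg_congr fun j h1 h2 => ?_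
      rw [hF _ (by omega) (by omega), hF _ (by omega) (by omega), Nat.add_right_comm,
        min_ordb_add hb (by omega)])
  rw [← hpe, Nat.sub_add_cancel hle] at hJ
  exact le_curl (blockSeg_ne_nil hpos) hJ

lemma curl_blockJoin_step (hm : 1 ≤ m) (H : {k : ℕ | curl (gPrefix (m + 1) k) ≤ m}.Infinite)
    {n s : ℕ} (hs : s < tau m (ordb (m + 1) (n + 1) + 1)) :
    max m (curl (blockJoin m (rulerBlock m) n ++ m :: gPrefix (m + 1) s))
      = max (m + 1) (curl (gPrefix (m + 1) s)) := by
  have h1 := lt_curl_of_lt_tau hm H hs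
  have h2 : curl (gPrefix (m + 1) s)
      ≤ curl (blockJoin m (rulerBlock m) n ++ m :: gPrefix (m + 1) s) :=
    curl_le_of_suffix ⟨blockJoin m (rulerBlock m) n ++ [m], by simp⟩
  have h3 : curl (blockJoin m (rulerBlock m) n ++ m :: gPrefix (m + 1) s)
      ≤ max (m + 1) (curl (gPrefix (m + 1) s)) := by
    rw [curl_le_iff (by omega)]
    intro X Y k hY h
    by_cases hmem : m ∈ Y
    · exact le_max_of_le_left (rulerBlock_power_le hm H hmem h).1
    · have hm' : m ∉ (List.replicate k Y).flatten := by simp [hmem]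
      obtain ⟨X', hX'⟩ := suffix_of_notMem hm' h
      exact le_max_of_le_right (le_curl hY hX'.symm)
  omega

lemma curl_blockJoin_le (hm : 1 ≤ m) (H : {k : ℕ | curl (gPrefix (m + 1) k) ≤ m}.Infinite)
    (n : ℕ) : curl (blockJoin m (rulerBlock m) n) ≤ m := by
  rcases n with _ | n
  · simpa [blockJoin, rulerBlock, curl_nil] using hm
  · rw [blockJoin, rulerBlock_of_pos (by omega), curl_le_iff hm]
    intro X Y k hY h
    by_cases hmem : m ∈ Y
    · exact (rulerBlock_power_le hm H hmem h).2 rfl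
    · have hm' : m ∉ (List.replicate k Y).flatten := by simp [hmem]
      obtain ⟨X', hX'⟩ := suffix_of_notMem hm' h
      exact (le_curl hY hX'.symm).trans (curl_Tstr_le H _)

lemma gPrefix_add_of_blockJoin (hm : 1 ≤ m)
    (H : {k : ℕ | curl (gPrefix (m + 1) k) ≤ m}.Infinite) {n : ℕ}
    (hn : gPrefix m (blockJoin m (rulerBlock m) n).length = blockJoin m (rulerBlock m) n) (s : ℕ)
    (hs : s ≤ tau m (ordb (m + 1) (n + 1) + 1)) :
    gPrefix m ((blockJoin m (rulerBlock m) n).length + 1 + s)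
      = blockJoin m (rulerBlock m) n ++ m :: gPrefix (m + 1) s := by
  induction s with
  | zero =>
    rw [Nat.add_zero]
    simp only [gPrefix]
    rw [hn, max_eq_left (curl_blockJoin_le hm H n)]
  | succ s ih =>
    rw [← Nat.add_assoc, gPrefix, ih (by omega), curl_blockJoin_step hm H (by omega), gPrefix]
    simp

/-- The prefix of `A^(m)` made of its first `n` blocks. -/
lemma gPrefix_length_blockJoin (hm : 1 ≤ m)
    (H : {k : ℕ | curl (gPrefix (m + 1) k) ≤ m}.Infinite) (n : ℕ) :
    gPrefix m (blockJoin m (rulerBlock m) n).length = blockJoin m (rulerBlock m) n := by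
  induction n with
  | zero => simp [blockJoin, rulerBlock, gPrefix]
  | succ n ih =>
    have h := gPrefix_add_of_blockJoin hm H ih _ le_rfl
    rw [blockJoin, rulerBlock_of_pos (by omega), Tstr, ← h, length_gPrefix]

lemma count_curl_le (hm : 1 ≤ m) (H : {k : ℕ | curl (gPrefix (m + 1) k) ≤ m}.Infinite) (n : ℕ) :
    Nat.count (fun k => curl (gPrefix m k) ≤ m) (blockJoin m (rulerBlock m) n).length = n := by
  induction n with
  | zero => simp [blockJoin, rulerBlock]
  | succ n ih =>
    have hn := gPrefix_length_blockJoin hm H n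
    have key : ∀ s ≤ tau m (ordb (m + 1) (n + 1) + 1),
        Nat.count (fun k => curl (gPrefix m k) ≤ m)
          ((blockJoin m (rulerBlock m) n).length + 1 + s) = n + 1 := by
      intro s hs
      induction s with
      | zero =>
        rw [Nat.add_zero, Nat.count_succ, ih, if_pos (by rw [hn]; exact curl_blockJoin_le hm H n)]
      | succ s ihs =>
        rw [← Nat.add_assoc, Nat.count_succ, ihs (by omega), if_neg]
        rw [gPrefix_add_of_blockJoin hm H hn s (by omega)]
        have := lt_curl_of_lt_tau hm H (show s < _ from hs)
        omega
    refine Eq.trans ?_ (key _ le_rfl)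
    rw [blockJoin, rulerBlock_of_pos (by omega), Tstr, List.length_append, List.length_cons,
      length_gPrefix]
    congr 1
    omega

lemma piStr_eq_blockJoin (hm : 1 ≤ m) (H : {k : ℕ | curl (gPrefix (m + 1) k) ≤ m}.Infinite)
    (n : ℕ) : piStr m n = blockJoin m (rulerBlock m) n := by
  have hn := gPrefix_length_blockJoin hm H n
  have : piLen m n = (blockJoin m (rulerBlock m) n).length := by
    conv_lhs => rw [piLen, ← count_curl_le hm H n]
    exact Nat.nth_count (p := fun k => curl (gPrefix m k) ≤ m)
      (by rw [hn]; exact curl_blockJoin_le hm H n)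
  rw [piStr, this, hn]

/-- Every prefix of `A^(m)` with curling number at most `m` is determined by its number of
occurrences of `m`. -/
lemma eq_blockJoin_count (hm : 1 ≤ m) (H : {k : ℕ | curl (gPrefix (m + 1) k) ≤ m}.Infinite)
    {k : ℕ} (hk : curl (gPrefix m k) ≤ m) :
    gPrefix m k = blockJoin m (rulerBlock m) ((gPrefix m k).count m) := by
  have h := Nat.nth_count (p := fun k => curl (gPrefix m k) ≤ m) hk
  have h2 : gPrefix m k = blockJoin m (rulerBlock m)
      (Nat.count (fun k => curl (gPrefix m k) ≤ m) k) := by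
    rw [← piStr_eq_blockJoin hm H, piStr, piLen, h]
  conv_rhs => rw [h2, count_blockJoin fun i _ => notMem_rulerBlock m i]
  exact h2

end Structure

/-! ### Repetitions at the end of an initial part of the block structure -/

lemma coeffAt_sub {b : ℕ} (hb : 2 ≤ b) {n q c : ℕ} (h : c ≤ coeffAt b n q) (i : ℕ) :
    coeffAt b (n - c * b ^ q) i = if i = q then coeffAt b n q - c else coeffAt b n i := by
  have hle := (le_coeffAt_iff hb n q c).1 h
  have hmod := Nat.mod_le n (b ^ (q + 1))
  have hq : coeffAt b (n - c * b ^ q) q = coeffAt b n q - c := by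
    have hdiv := Nat.div_add_mod n (b ^ (q + 1))
    have hlt := Nat.mod_lt n (y := b ^ (q + 1)) (by positivity)
    have hsplit : n - c * b ^ q
        = b ^ (q + 1) * (n / b ^ (q + 1)) + (n % b ^ (q + 1) - c * b ^ q) := by omega
    rw [coeffAt_eq_mod_div, coeffAt_eq_mod_div, hsplit, Nat.mul_add_mod,
      Nat.mod_eq_of_lt (by omega), Nat.mul_comm c, Nat.sub_mul_div]
  split_ifs with hi
  · rw [hi, hq]
  · have hlt := coeffAt_lt hb n q
    have := coeffAt_add hb (n := n - c * b ^ q) (q := q) (c := c) (by omega) i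
    rw [if_neg hi, Nat.sub_add_cancel (by omega)] at this
    exact this.symm

lemma ordb_eq_iff_coeffAt {b n : ℕ} (hb : 2 ≤ b) (hn : 1 ≤ n) (p : ℕ) :
    ordb b n = p ↔ (∀ i < p, coeffAt b n i = 0) ∧ coeffAt b n p ≠ 0 := by
  rw [ordb_eq_iff hb hn, pow_dvd_iff_coeffAt hb, pow_dvd_iff_coeffAt hb, Nat.forall_lt_succ_right]
  tauto

section Repetitions

variable {m : ℕ}

lemma blockJoin_window (hm : 1 ≤ m) {x q c k : ℕ}
    (h : k * (c * (m + 1) ^ q) ≤ x % (m + 1) ^ (q + 1)) :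
    blockJoin m (rulerBlock m) x = blockJoin m (rulerBlock m) (x - k * (c * (m + 1) ^ q)) ++
      (List.replicate k (blockSeg m (rulerBlock m) (x - k * (c * (m + 1) ^ q))
        (c * (m + 1) ^ q))).flatten := by
  have hle := h.trans (Nat.mod_le _ _)
  rw [← blockJoin_eq_of_periodic k, Nat.sub_add_cancel hle]
  intro i hi
  refine blockSeg_congr fun j h1 h2 => ?_
  rw [rulerBlock_of_pos (by omega), rulerBlock_of_pos (by omega),
    ordb_window (by omega) h hi h1 h2]

lemma coeffAt_le_curl_blockJoin (hm : 1 ≤ m) (x q : ℕ) :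
    coeffAt (m + 1) x q ≤ curl (blockJoin m (rulerBlock m) x) := by
  have h := (le_coeffAt_iff (b := m + 1) (by omega) x q _).1 le_rfl
  refine le_curl (blockSeg_ne_nil ?_) (blockJoin_window hm (c := 1) (by rwa [Nat.one_mul]))
  rw [Nat.one_mul]
  exact Nat.one_le_iff_ne_zero.2 (by positivity)

lemma blockJoin_succ_eq (m x : ℕ) : blockJoin m (rulerBlock m) (x + 1)
    = blockJoin m (rulerBlock m) x ++ m :: Tstr m (ordb (m + 1) (x + 1) + 1) := by
  rw [blockJoin, rulerBlock_of_pos (by omega)]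

lemma blockJoin_eq_of_pos {x : ℕ} (hx : 1 ≤ x) : ∃ W, blockJoin m (rulerBlock m) x
    = W ++ m :: Tstr m (ordb (m + 1) x + 1) := by
  obtain ⟨x, rfl⟩ := Nat.exists_eq_add_of_le' hx
  exact ⟨_, blockJoin_succ_eq m x⟩

/-- A suffix of `T_t` that extends `T_t` to the next longer block occurring produces a square. -/
lemma one_lt_curl_blockJoin (hm : 1 ≤ m) {x r : ℕ} (hx : 1 ≤ x)
    (hdig : ∀ i, coeffAt (m + 1) x i ≤ 1) (hpr : ordb (m + 1) x < r)
    (hr : coeffAt (m + 1) x r ≠ 0)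
    (hmin : ∀ i, ordb (m + 1) x < i → i < r → coeffAt (m + 1) x i = 0) {Z : List ℕ}
    (hZ : Z <:+ Tstr m (ordb (m + 1) x + 1))
    (hTZ : Tstr m (ordb (m + 1) x + 1) ++ Z = Tstr m (r + 1)) :
    ¬ curl (blockJoin m (rulerBlock m) x) ≤ 1 := by
  have hb : 2 ≤ m + 1 := by omega
  set p := ordb (m + 1) x with hp
  obtain ⟨hp0, hp1⟩ := (ordb_eq_iff_coeffAt hb hx p).1 rfl
  have hpd : coeffAt (m + 1) x p = 1 := by have := hdig p; omega
  have hsub := coeffAt_sub hb (n := x) (q := p) (c := 1) hpd.ge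
  rw [Nat.one_mul] at hsub
  have hepos : 1 ≤ (m + 1) ^ p := Nat.one_le_iff_ne_zero.2 (by positivity)
  have hrb : (m + 1) ^ r ≤ x - (m + 1) ^ p := by
    have h1 : 1 ≤ coeffAt (m + 1) (x - (m + 1) ^ p) r := by
      rw [hsub, if_neg hpr.ne']; omega
    rw [le_coeffAt_iff hb, Nat.one_mul] at h1
    exact h1.trans (Nat.mod_le _ _)
  have hpow : (m + 1) * (m + 1) ^ p ≤ (m + 1) ^ r := by
    rw [← pow_succ']; exact Nat.pow_le_pow_right (by omega) hpr
  have h2e : 2 * (m + 1) ^ p ≤ (m + 1) * (m + 1) ^ p := Nat.mul_le_mul_right _ hb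
  have hord1 : ordb (m + 1) (x - (m + 1) ^ p) = r := by
    rw [ordb_eq_iff_coeffAt hb (by omega)]
    refine ⟨fun i hi => ?_, by rwa [hsub, if_neg hpr.ne']⟩
    rw [hsub]
    split_ifs with h
    · omega
    · rcases lt_or_gt_of_ne h with h' | h'
      · exact hp0 i h'
      · exact hmin i h' hi
  have hdx : (m + 1) ^ p ∣ x := (pow_dvd_iff_le_ordb hb hx _).2 le_rfl
  have hd1 : (m + 1) ^ (p + 1) ∣ x - (m + 1) ^ p :=
    (pow_dvd_iff_le_ordb hb (by omega) _).2 (by omega)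
  clear_value p
  obtain ⟨w, rfl⟩ : ∃ w, x = w + (m + 1) ^ p + (m + 1) ^ p :=
    ⟨x - (m + 1) ^ p - (m + 1) ^ p, by omega⟩
  rw [Nat.add_sub_cancel] at hord1 hrb hd1
  have hdw : (m + 1) ^ p ∣ w := by
    simpa using hdx
  have hordw : ordb (m + 1) w = p := by
    rw [ordb_eq_iff hb (by omega)]
    refine ⟨hdw, fun h => ?_⟩
    have h' := (Nat.dvd_add_iff_right h).2 hd1
    have := Nat.le_of_dvd (by omega) h'
    rw [pow_succ'] at this
    omega
  obtain ⟨W, hW⟩ := blockJoin_eq_of_pos (m := m) (x := w) (by omega)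
  rw [hordw] at hW
  obtain ⟨V, hV⟩ := hZ
  obtain ⟨e, he⟩ := Nat.exists_eq_add_of_le' hepos
  have hseg : blockSeg m (rulerBlock m) (w + (m + 1) ^ p) e = blockSeg m (rulerBlock m) w e := by
    refine blockSeg_congr fun j h1 h2 => ?_
    have hnd : ¬ (m + 1) ^ p ∣ w + j := fun h => by
      have := Nat.le_of_dvd (by omega) ((Nat.dvd_add_iff_right hdw).2 h)
      omega
    rw [rulerBlock_of_pos (by omega), rulerBlock_of_pos (by omega), Nat.add_right_comm,
      ordb_add_eq (Q := p) hb (fun z hz => pow_dvd_pow _ hz.le) hnd]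
    rwa [Nat.dvd_add_left dvd_rfl]
  have hJ : blockJoin m (rulerBlock m) (w + (m + 1) ^ p + (m + 1) ^ p)
      = W ++ m :: Tstr m (p + 1) ++ (blockSeg m (rulerBlock m) w e ++ m :: Tstr m (r + 1)) ++
        (blockSeg m (rulerBlock m) w e ++ m :: Tstr m (p + 1)) := by
    rw [blockJoin_add, blockJoin_add, hW]
    congr 1
    · congr 1
      conv_lhs => rw [he]
      rw [blockSeg, Nat.add_assoc, ← he, rulerBlock_of_pos (by omega), hord1]
    · conv_lhs => arg 4; rw [he]
      rw [blockSeg, hseg, Nat.add_assoc (w + (m + 1) ^ p), ← he, rulerBlock_of_pos (by omega), ← hp]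
  rw [hJ, curl_le_one_iff]
  push Not
  refine ⟨Z ++ (blockSeg m (rulerBlock m) w e ++ m :: Tstr m (p + 1)), by simp, W ++ m :: V, ?_⟩
  rw [← hTZ]
  conv_rhs => lhs; lhs; rw [← hV]
  simp only [List.append_assoc, List.cons_append]

lemma curl_blockJoin_le_one_of_forall (hm : 1 ≤ m)
    (H : {k : ℕ | curl (gPrefix (m + 1) k) ≤ m}.Infinite) {x : ℕ} (hx : 1 ≤ x)
    (hT : curl (Tstr m (ordb (m + 1) x + 1)) ≤ 1) (hdig : ∀ i, coeffAt (m + 1) x i ≤ 1)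
    (hZr : ∀ r, ordb (m + 1) x < r → coeffAt (m + 1) x r ≠ 0 →
      (∀ i, ordb (m + 1) x < i → i < r → coeffAt (m + 1) x i = 0) →
      ¬ ∃ Z, Z ≠ [] ∧ Z <:+ Tstr m (ordb (m + 1) x + 1) ∧
        Tstr m (ordb (m + 1) x + 1) ++ Z = Tstr m (r + 1)) :
    curl (blockJoin m (rulerBlock m) x) ≤ 1 := by
  have hb : 2 ≤ m + 1 := by omega
  rw [curl_le_one_iff]
  rintro Y hY ⟨X, hXY⟩
  by_cases hmem : m ∈ Y
  swap
  · obtain ⟨W, hW⟩ := blockJoin_eq_of_pos (m := m) hx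
    have hsuf := suffix_of_notMem (by simpa using hmem) (hW.symm.trans hXY.symm)
    exact curl_le_one_iff.1 hT Y hY hsuf
  obtain ⟨Z, R, rfl, hZm, hke, heq, hper, hsuf⟩ := blockJoin_power (k := 2) (X := X)
    (fun i _ => notMem_rulerBlock m i) (by omega) hmem
    (by rw [← hXY]; simp [List.replicate_succ])
  have he : 1 ≤ (Z ++ m :: R).count m := List.count_pos_iff.2 hmem
  generalize (Z ++ m :: R).count m = e at he hke heq hper hsuf
  have hT1 := heq 1 le_rfl (by omega)
  rw [Nat.one_mul, rulerBlock_of_pos (by omega), rulerBlock_of_pos hx] at hT1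
  have hper' : ∀ i < 2, ∀ j, 1 ≤ j → j < e →
      ordb (m + 1) (x - i * e - j) = ordb (m + 1) (x - j) := by
    intro i hi j hj hje
    have hle : i * e ≤ 1 * e := Nat.mul_le_mul_right _ (by omega)
    have := hper i hi j hj hje
    rw [rulerBlock_of_pos (by omega), rulerBlock_of_pos (by omega)] at this
    exact Tstr_injective H this
  by_cases hZ0 : Z = []
  · rw [hZ0, List.append_nil] at hT1
    obtain ⟨q, c, hc, -, hle⟩ := ruler_square hb he hke fun j hj => by
      rcases Nat.eq_zero_or_pos j with rfl | hj'
      · simpa using Tstr_injective H hT1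
      · simpa using hper' 1 (by omega) j hj' hj
    rw [← Nat.mul_assoc, ← le_coeffAt_iff hb] at hle
    have := hdig q
    omega
  have hx2 : 1 ≤ x - 2 * e := by
    by_contra! h0
    rw [Nat.lt_one_iff.1 h0, rulerBlock, if_pos rfl] at hsuf
    exact hZ0 (List.suffix_nil.1 hsuf)
  rw [rulerBlock_of_pos hx2] at hsuf
  set p := ordb (m + 1) x with hp
  set r := ordb (m + 1) (x - e) with hr
  have hpr : p < r := by
    refine lt_of_tau_lt H ?_
    have hlen := congrArg List.length hT1
    rw [Tstr, Tstr, List.length_append, length_gPrefix, length_gPrefix] at hlen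
    have := List.length_pos_iff.2 hZ0
    omega
  have hdx := (ordb_eq_iff hb hx p).1 rfl
  have hdxe : (m + 1) ^ (p + 1) ∣ x - e := (pow_dvd_iff_le_ordb hb (by omega) _).2 hpr
  have hdxe' : (m + 1) ^ p ∣ x - e := (pow_dvd_pow _ (Nat.le_succ p)).trans hdxe
  have hxe : x = x - e + e := by omega
  have hde : (m + 1) ^ p ∣ e := by
    rw [hxe] at hdx; exact (Nat.dvd_add_iff_right hdxe').2 hdx.1
  have hnde : ¬ (m + 1) ^ (p + 1) ∣ e := fun h => hdx.2 (by
    rw [hxe]; exact Nat.dvd_add hdxe h)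
  have horde : ordb (m + 1) e = p := (ordb_eq_iff hb he p).2 ⟨hde, hnde⟩
  have hepow : e < (m + 1) ^ (p + 1) := by
    by_contra! hge
    have hpos : 0 < (m + 1) ^ (p + 1) := by positivity
    have hne : e ≠ (m + 1) ^ (p + 1) := fun h => hnde h.symm.dvd
    obtain ⟨i, hi, hi'⟩ := multiple_in_window hb he le_rfl hke hper'
      (y := x - e - (m + 1) ^ (p + 1)) (by omega) (by omega)
      (by rw [horde]; exact Nat.dvd_sub hdxe dvd_rfl)
    have hle : i * e ≤ 1 * e := Nat.mul_le_mul_right _ (by omega)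
    omega
  obtain ⟨c, hc⟩ := hde
  have hcb : c < m + 1 := by
    rw [hc, pow_succ] at hepow
    exact Nat.lt_of_mul_lt_mul_left hepow
  obtain ⟨hr0, hr1⟩ := (ordb_eq_iff_coeffAt hb (by omega) r).1 hr.symm
  have hadd := coeffAt_add hb (n := x - e) (q := p) (c := c) (by rw [hr0 p hpr]; omega)
  rw [Nat.mul_comm, ← hc, ← hxe] at hadd
  have hord2 : ordb (m + 1) (x - 2 * e) = p := by
    rw [ordb_eq_iff hb hx2, show x - 2 * e = x - e - e by omega]
    refine ⟨Nat.dvd_sub hdxe' ⟨c, hc⟩, fun h => hnde ?_⟩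
    have := Nat.dvd_sub hdxe h
    rwa [Nat.sub_sub_self (by omega)] at this
  rw [hord2] at hsuf
  refine hZr r hpr (by rwa [hadd, if_neg hpr.ne']) (fun i h1 h2 => ?_) ⟨Z, hZ0, hsuf, hT1.symm⟩
  rw [hadd, if_neg h1.ne', hr0 i h2]

lemma curl_blockJoin_le_one_iff (hm : 1 ≤ m)
    (H : {k : ℕ | curl (gPrefix (m + 1) k) ≤ m}.Infinite) {x : ℕ} (hx : 1 ≤ x) :
    curl (blockJoin m (rulerBlock m) x) ≤ 1 ↔
      curl (Tstr m (ordb (m + 1) x + 1)) ≤ 1 ∧ (∀ i, coeffAt (m + 1) x i ≤ 1) ∧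
      ∀ r, ordb (m + 1) x < r → coeffAt (m + 1) x r ≠ 0 →
        (∀ i, ordb (m + 1) x < i → i < r → coeffAt (m + 1) x i = 0) →
        ¬ ∃ Z, Z ≠ [] ∧ Z <:+ Tstr m (ordb (m + 1) x + 1) ∧
          Tstr m (ordb (m + 1) x + 1) ++ Z = Tstr m (r + 1) := by
  refine ⟨fun h => ?_, fun ⟨h1, h2, h3⟩ => curl_blockJoin_le_one_of_forall hm H hx h1 h2 h3⟩
  have hdig := fun i => (coeffAt_le_curl_blockJoin hm x i).trans h
  obtain ⟨W, hW⟩ := blockJoin_eq_of_pos (m := m) hx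
  refine ⟨(curl_le_of_suffix ⟨W ++ [m], ?_⟩).trans h, hdig, ?_⟩
  · rw [hW]; simp
  · rintro r hpr hr hmin ⟨Z, -, hZ, hTZ⟩
    exact one_lt_curl_blockJoin hm hx hdig hpr hr hmin hZ hTZ h

/-- The self-overlaps extending an initial part of the block structure, in terms of digits. -/
lemma overlap_iff (hm : 1 ≤ m) (H : {k : ℕ | curl (gPrefix (m + 1) k) ≤ m}.Infinite)
    (x x' : ℕ) :
    (∃ Z, Z ≠ [] ∧ Z <:+ blockJoin m (rulerBlock m) x ∧
      blockJoin m (rulerBlock m) x ++ Z = blockJoin m (rulerBlock m) x') ↔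
    x < x' ∧ ∃ y, (∀ i, i ≠ y → coeffAt (m + 1) x i = coeffAt (m + 1) x' i) ∧
      coeffAt (m + 1) x' y ≤ 2 * coeffAt (m + 1) x y := by
  have hb : 2 ≤ m + 1 := by omega
  constructor
  · rintro ⟨Z, hZ0, ⟨V, hV⟩, hZ⟩
    have hcount := congrArg (List.count m) hZ
    rw [List.count_append, count_blockJoin fun i _ => notMem_rulerBlock m i,
      count_blockJoin fun i _ => notMem_rulerBlock m i] at hcount
    have hlt : x < x' := by
      by_contra! hle
      obtain rfl : x = x' := by omega
      exact hZ0 (by simpa using hZ)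
    obtain ⟨d, rfl⟩ := Nat.exists_eq_add_of_lt hlt
    have hmem : m ∈ Z := List.count_pos_iff.1 (by omega)
    have hseg : Z = blockSeg m (rulerBlock m) x (d + 1) := by
      rw [Nat.add_assoc, blockJoin_add] at hZ
      exact List.append_cancel_left hZ
    obtain ⟨Z', R, hZR, hZm, hke, heq, hper, -⟩ := blockJoin_power (k := 2) (X := V)
      (fun i _ => notMem_rulerBlock m i) (by omega) hmem
      (by rw [← hZ, ← hV]; simp [List.replicate_succ])
    obtain ⟨Q, hQ⟩ := blockSeg_eq_cons m (rulerBlock m) x d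
    obtain rfl : Z' = [] := by
      rcases Z' with _ | ⟨z, Z'⟩
      · rfl
      · rw [hseg, hQ] at hZR
        have := (List.cons.inj hZR).1
        simp [this] at hZm
    have hce : Z.count m = d + 1 := by omega
    rw [hce] at hke heq hper
    obtain ⟨q, c, hc, hcd, hle⟩ := ruler_square hb (Nat.le_add_left 1 d) hke fun j hj => by
      refine Tstr_injective H ?_
      rw [← rulerBlock_of_pos (by omega), ← rulerBlock_of_pos (by omega)]
      rcases Nat.eq_zero_or_pos j with rfl | hj'
      · simpa using heq 1 le_rfl (by omega)
      · simpa using hper 1 (by omega) j hj' hj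
    rw [← Nat.mul_assoc, ← le_coeffAt_iff hb] at hle
    have hsub := coeffAt_sub hb (n := x + d + 1) (q := q) (c := c) (by omega)
    rw [← hcd, show x + d + 1 - (d + 1) = x by omega] at hsub
    refine ⟨hlt, q, fun i hi => by rw [hsub, if_neg hi], ?_⟩
    rw [hsub, if_pos rfl]
    omega
  · rintro ⟨hlt, y, hoff, hy⟩
    have hx' := coeffAt_lt hb x' y
    have hx := coeffAt_lt hb x y
    have hyy : coeffAt (m + 1) x y < coeffAt (m + 1) x' y := by
      by_contra! hle
      have : x = x' + (coeffAt (m + 1) x y - coeffAt (m + 1) x' y) * (m + 1) ^ y := by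
        refine coeffAt_ext hb fun i => ?_
        rw [coeffAt_add hb (by omega)]
        split_ifs with h
        · rw [h]; omega
        · exact hoff i h
      omega
    obtain ⟨c, hc⟩ := Nat.exists_eq_add_of_lt hyy
    have hxx : x' = x + (c + 1) * (m + 1) ^ y := by
      refine coeffAt_ext hb fun i => ?_
      rw [coeffAt_add hb (by omega)]
      split_ifs with h
      · rw [h]; omega
      · exact (hoff i h).symm
    have hle : 2 * (c + 1) ≤ coeffAt (m + 1) x' y := by omega
    rw [le_coeffAt_iff hb, Nat.mul_assoc] at hle
    have hJ := blockJoin_window hm hle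
    have hdpos : 1 ≤ (c + 1) * (m + 1) ^ y := Nat.one_le_iff_ne_zero.2 (by positivity)
    have hmod := Nat.mod_le x' ((m + 1) ^ (y + 1))
    generalize (c + 1) * (m + 1) ^ y = d at hJ hdpos hxx hle
    have hJ' := blockJoin_add m (rulerBlock m) (x' - 2 * d) d
    rw [show x' - 2 * d + d = x by omega] at hJ'
    refine ⟨_, blockSeg_ne_nil hdpos, ⟨_, hJ'.symm⟩, ?_⟩
    rw [hJ, hJ']
    simp [List.replicate_succ]

end Repetitions

/-! ### Digit transfer and the level expansion -/

lemma getD_digits_eq_coeffAt {b : ℕ} (hb : 2 ≤ b) (n i : ℕ) :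
    (Nat.digits b n).getD i 0 = coeffAt b n i := Nat.getD_digits n i hb

lemma digits_chi {b : ℕ} (hb : 2 ≤ b) (a : ℕ) :
    Nat.digits (b + 1) (chi b a) = Nat.digits b a :=
  Nat.digits_ofDigits _ (by omega) _
    (fun l hl => (Nat.digits_lt_base (by omega) hl).trans (Nat.lt_succ_self b))
    fun h => Nat.getLast_digit_ne_zero b (Nat.digits_ne_nil_iff_ne_zero.1 h)

lemma coeffAt_chi {b : ℕ} (hb : 2 ≤ b) (a i : ℕ) :
    coeffAt (b + 1) (chi b a) i = coeffAt b a i := by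
  rw [← getD_digits_eq_coeffAt (by omega), ← getD_digits_eq_coeffAt hb, digits_chi hb]

lemma chi_pos {b a : ℕ} (hb : 2 ≤ b) (ha : 1 ≤ a) : 1 ≤ chi b a := by
  refine Nat.one_le_iff_ne_zero.2 fun h => ?_
  have := digits_chi hb a
  rw [h, Nat.digits_zero] at this
  have := Nat.digits_eq_nil_iff_eq_zero.1 this.symm
  omega

lemma ordb_chi {b a : ℕ} (hb : 2 ≤ b) (ha : 1 ≤ a) : ordb (b + 1) (chi b a) = ordb b a := by
  rw [ordb_eq_iff_coeffAt (by omega) (chi_pos hb ha)]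
  simp only [coeffAt_chi hb]
  exact (ordb_eq_iff_coeffAt hb ha _).1 rfl

lemma maxdigit_le_one_iff {b : ℕ} (hb : 2 ≤ b) (a : ℕ) :
    maxdigit b a ≤ 1 ↔ ∀ i, coeffAt b a i ≤ 1 := by
  have h : ∀ L : List ℕ, L.foldr max 0 ≤ 1 ↔ ∀ i, L.getD i 0 ≤ 1 := by
    intro L
    induction L with
    | nil => simp
    | cons d L ih =>
      rw [List.foldr_cons, max_le_iff, ih]
      refine ⟨fun ⟨h1, h2⟩ i => ?_,
        fun h => ⟨by simpa using h 0, fun i => by simpa using h (i + 1)⟩⟩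
      rcases i with _ | i
      · simpa using h1
      · simpa using h2 i
  rw [maxdigit, h]
  simp only [getD_digits_eq_coeffAt hb]

lemma isSecondNonzero_succ_iff {b : ℕ} (hb : 2 ≤ b) (a r : ℕ) :
    IsSecondNonzero b a (r + 1) ↔ ordb b a < r ∧ coeffAt b a r ≠ 0 ∧
      ∀ i, ordb b a < i → i < r → coeffAt b a i = 0 := by
  simp only [IsSecondNonzero, digitAt, getD_digits_eq_coeffAt hb, Nat.add_lt_add_iff_right,
    Nat.add_sub_cancel]
  refine and_congr_right fun _ => and_congr_right fun _ =>
    ⟨fun h i h1 h2 => ?_, fun h i h1 h2 => ?_⟩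
  · simpa using h (i + 1) (by omega) (by omega)
  · exact h (i - 1) (by omega) (by omega)

lemma mem_Sset_iff {b a a' : ℕ} (hb : 2 ≤ b) : (a, a') ∈ Sset b ↔ a < a' ∧
    ∃ y, (∀ i, i ≠ y → coeffAt b a i = coeffAt b a' i) ∧
      coeffAt b a' y ≤ 2 * coeffAt b a y := by
  simp only [Sset, Set.mem_ofPred_eq, getD_digits_eq_coeffAt hb]
  refine ⟨fun h => h.2, fun ⟨hlt, y, hoff, hy⟩ => ⟨Nat.one_le_iff_ne_zero.2 ?_, hlt, y, hoff, hy⟩⟩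
  rintro rfl
  refine hlt.ne (coeffAt_ext hb fun i => ?_)
  by_cases hi : i = y
  · subst hi
    have h0 : coeffAt b 0 i = 0 := by simp [coeffAt]
    omega
  · exact hoff i hi

lemma lt_of_coeffAt {b n n' y : ℕ} (hb : 2 ≤ b)
    (hoff : ∀ i, i ≠ y → coeffAt b n i = coeffAt b n' i)
    (hy : coeffAt b n y < coeffAt b n' y) : n < n' := by
  have hlt := coeffAt_lt hb n' y
  obtain ⟨c, hc⟩ := Nat.exists_eq_add_of_lt hy
  have : n' = n + (c + 1) * b ^ y := by
    refine coeffAt_ext hb fun i => ?_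
    rw [coeffAt_add hb (by omega)]
    split_ifs with h
    · rw [h]; omega
    · exact (hoff i h).symm
  have : 0 < (c + 1) * b ^ y := by positivity
  omega

lemma lt_iff_of_coeffAt {b n n' y : ℕ} (hb : 2 ≤ b)
    (hoff : ∀ i, i ≠ y → coeffAt b n i = coeffAt b n' i) :
    n < n' ↔ coeffAt b n y < coeffAt b n' y := by
  refine ⟨fun h => ?_, lt_of_coeffAt hb hoff⟩
  by_contra! hle
  rcases hle.lt_or_eq with hlt | heq
  · exact absurd (lt_of_coeffAt hb (fun i hi => (hoff i hi).symm) hlt) h.not_gt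
  · refine h.ne (coeffAt_ext hb fun i => ?_)
    by_cases hi : i = y
    · rw [hi, heq]
    · exact hoff i hi

lemma coeffAt_count_lt (hSH : StandingHyp) {m : ℕ} (hm : 1 ≤ m) {k : ℕ}
    (hk : curl (gPrefix (m + 1) k) ≤ m) (i : ℕ) :
    coeffAt (m + 2) ((gPrefix (m + 1) k).count (m + 1)) i < m + 1 := by
  have h := coeffAt_le_curl_blockJoin (m := m + 1) (by omega)
    ((gPrefix (m + 1) k).count (m + 1)) i
  rw [← eq_blockJoin_count (by omega) (hSH (m + 1) (by omega)).2 (hk.trans m.le_succ)] at h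
  exact Nat.lt_succ_of_le (h.trans hk)

lemma digits_ofDigits_digits_count (hSH : StandingHyp) {m : ℕ} (hm : 1 ≤ m) {k : ℕ}
    (hk : curl (gPrefix (m + 1) k) ≤ m) :
    Nat.digits (m + 1)
      (Nat.ofDigits (m + 1) (Nat.digits (m + 2) ((gPrefix (m + 1) k).count (m + 1))))
      = Nat.digits (m + 2) ((gPrefix (m + 1) k).count (m + 1)) := by
  refine Nat.digits_ofDigits _ (by omega) _ (fun l hl => ?_)
    fun h => Nat.getLast_digit_ne_zero _ (Nat.digits_ne_nil_iff_ne_zero.1 h)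
  obtain ⟨i, hi, rfl⟩ := List.mem_iff_getElem.1 hl
  rw [← List.getD_eq_getElem _ 0 hi, getD_digits_eq_coeffAt (by omega)]
  exact coeffAt_count_lt hSH hm hk i

lemma chi_iota (hSH : StandingHyp) {m : ℕ} (hm : 1 ≤ m) (t : ℕ) :
    chi (m + 1) (iota m t) = (Tstr m t).count (m + 1) := by
  rw [chi, iota, Tstr, digits_ofDigits_digits_count hSH hm (curl_Tstr_le (hSH m hm).2 t),
    Nat.ofDigits_digits]

lemma Tstr_eq_blockJoin (hSH : StandingHyp) {m : ℕ} (hm : 1 ≤ m) (t : ℕ) : Tstr m t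
    = blockJoin (m + 1) (rulerBlock (m + 1)) (chi (m + 1) (iota m t)) := by
  rw [chi_iota hSH hm]
  exact eq_blockJoin_count (by omega) (hSH (m + 1) (by omega)).2
    ((curl_Tstr_le (hSH m hm).2 t).trans m.le_succ)

lemma overlap_iff_mem_Sset (hSH : StandingHyp) {m : ℕ} (hm : 1 ≤ m) (t u : ℕ) :
    (∃ Z, Z ≠ [] ∧ Z <:+ Tstr m t ∧ Tstr m t ++ Z = Tstr m u) ↔
      (iota m t, iota m u) ∈ Sset (m + 1) := by
  rw [Tstr_eq_blockJoin hSH hm t, Tstr_eq_blockJoin hSH hm u,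
    overlap_iff (by omega) (hSH (m + 1) (by omega)).2, mem_Sset_iff (by omega), ← exists_and_left,
    ← exists_and_left]
  refine exists_congr fun y => ?_
  simp only [coeffAt_chi (b := m + 1) (by omega)]
  rw [← and_assoc, ← and_assoc]
  refine and_congr_left fun _ => and_congr_left fun hoff => ?_
  rw [lt_iff_of_coeffAt (by omega) hoff, lt_iff_of_coeffAt (b := m + 1 + 1) (y := y) (by omega)]
  · simp only [coeffAt_chi (b := m + 1) (by omega)]
  · simpa only [coeffAt_chi (b := m + 1) (by omega)] using hoff

lemma curl_piStr_chi_le_one_iff (hSH : StandingHyp) {l a : ℕ} (hl : 2 ≤ l) (ha : 1 ≤ a) :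
    curl (piStr l (chi l a)) ≤ 1 ↔ curl (Tstr l (ordb l a + 1)) ≤ 1 ∧ maxdigit l a ≤ 1 ∧
      ∀ u, IsSecondNonzero l a u → (iota l (ordb l a + 1), iota l u) ∉ Sset (l + 1) := by
  have H := (hSH l (by omega)).2
  rw [piStr_eq_blockJoin (by omega) H, curl_blockJoin_le_one_iff (by omega) H (chi_pos hl ha),
    ordb_chi hl ha, maxdigit_le_one_iff hl]
  simp only [coeffAt_chi hl, overlap_iff_mem_Sset hSH (m := l) (by omega)]
  refine and_congr_right fun _ => and_congr_right fun _ =>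
    ⟨fun h u hu => ?_, fun h r h1 h2 h3 => ?_⟩
  · rcases u with _ | r
    · exact absurd hu.1 (by omega)
    · obtain ⟨h1, h2, h3⟩ := (isSecondNonzero_succ_iff hl a r).1 hu
      exact h r h1 h2 h3
  · exact h _ ((isSecondNonzero_succ_iff hl a r).2 ⟨h1, h2, h3⟩)

lemma lexpAux_succ (m a k : ℕ) :
    lexpAux m a (k + 1) = lexpAux (m + 1) (iota (m + 1) (ordb (m + 1) a + 1)) k := by
  induction k with
  | zero => rfl
  | succ k ih =>
    rw [lexpAux, ih, lexpAux, show m + 1 + (k + 1) = m + 1 + 1 + k by omega]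

lemma lexp_of_lt {m l : ℕ} (h : m + 1 < l) (a : ℕ) :
    lexp m a l = lexp (m + 1) (iota (m + 1) (ordb (m + 1) a + 1)) l := by
  rw [lexp, lexp, show l - (m + 1) = l - (m + 1 + 1) + 1 by omega, lexpAux_succ]

lemma lexp_self (m a : ℕ) : lexp m a (m + 1) = a := by
  rw [lexp, Nat.sub_self, lexpAux]

lemma curl_piStr_le_one_iff_forall (hSH : StandingHyp) {m a : ℕ} (hm : 1 ≤ m) (ha : 1 ≤ a) :
    (curl (piStr (m + 1) (chi (m + 1) a)) ≤ 1 ↔ ∀ l, m + 1 ≤ l → l ≤ levelEnd m a →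
      maxdigit l (lexp m a l) ≤ 1 ∧ ∀ u, IsSecondNonzero l (lexp m a l) u →
        (iota l (ordb l (lexp m a l) + 1), iota l u) ∉ Sset (l + 1)) := by
  induction hL : (piStr (m + 1) (chi (m + 1) a)).length using Nat.strong_induction_on
    generalizing m a with
  | _ L ih =>
  have hchi : 1 ≤ chi (m + 1) a := chi_pos (by omega) ha
  obtain ⟨W, hW⟩ := blockJoin_eq_of_pos (m := m + 1) hchi
  rw [ordb_chi (by omega) ha, ← piStr_eq_blockJoin (by omega) (hSH (m + 1) (by omega)).2] at hW
  rw [curl_piStr_chi_le_one_iff hSH (by omega) ha]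
  have hT := Tstr_eq_blockJoin hSH (m := m + 1) (by omega) (ordb (m + 1) a + 1)
  set T := Tstr (m + 1) (ordb (m + 1) a + 1) with hTdef
  set a' := iota (m + 1) (ordb (m + 1) a + 1)
  rcases Nat.eq_zero_or_pos a' with h0 | hpos
  · have hT0 : T = [] := by rw [hT, h0]; simp [chi, blockJoin, rulerBlock]
    have hend : levelEnd m a = m + 1 := by rw [levelEnd, hW, hT0]; simp
    rw [hend, hT0, curl_nil]
    constructor
    · rintro ⟨-, h⟩ l h1 h2
      obtain rfl : l = m + 1 := by omega
      rwa [lexp_self]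
    · intro h
      have := h (m + 1) le_rfl le_rfl
      rw [lexp_self] at this
      exact ⟨le_rfl, this⟩
  · have hTne : T ≠ [] := by
      intro h
      have hc := chi_pos (b := m + 1 + 1) (by omega) hpos
      rw [chi_iota hSH (by omega), ← hTdef, h] at hc
      simp at hc
    have hTpi : piStr (m + 1 + 1) (chi (m + 1 + 1) a') = T := by
      rw [hT, piStr_eq_blockJoin (by omega) (hSH (m + 1 + 1) (by omega)).2]
    have hend : levelEnd m a = levelEnd (m + 1) a' := by
      rw [levelEnd, levelEnd, hTpi, hW, List.getLastD_eq_getLast?, List.getLastD_eq_getLast?]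
      rw [List.getLast?_append_of_ne_nil _ (by simp), List.getLast?_eq_some_getLast hTne,
        ← List.singleton_append, List.getLast?_append_of_ne_nil _ hTne,
        List.getLast?_eq_some_getLast hTne]
    have hge : m + 1 + 1 ≤ levelEnd (m + 1) a' := by
      refine le_of_mem_gPrefix (n := tau (m + 1) (ordb (m + 1) a + 1)) ?_
      rw [levelEnd, hTpi, List.getLastD_eq_getLast?, List.getLast?_eq_some_getLast hTne]
      exact List.getLast_mem hTne
    rw [← hTpi, ih _ ?_ (by omega) hpos rfl, hend]
    · constructor
      · rintro ⟨h, h'⟩ l h1 h2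
        rcases h1.lt_or_eq with h1 | rfl
        · rw [lexp_of_lt h1]
          exact h l h1 h2
        · rwa [lexp_self]
      · intro h
        refine ⟨fun l h1 h2 => ?_, ?_⟩
        · have := h l (by omega) h2
          rwa [lexp_of_lt h1] at this
        · have := h (m + 1) le_rfl (by omega)
          rwa [lexp_self] at this
    · rw [hTpi, ← hL, hW]
      simp only [List.length_append, List.length_cons]
      omega

lemma curl_piStr_two_iff (hSH : StandingHyp) (a : ℕ) :
    curl (piStr 2 (chi 2 a)) ≤ 1 ↔ ∃ t : ℕ, 1 ≤ t ∧ iota 1 t = a := by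
  constructor
  · intro h
    obtain ⟨t, ht⟩ := exists_tau_eq (hSH 1 le_rfl).2 h
    refine ⟨t + 1, by omega, ?_⟩
    have hT : Tstr 1 (t + 1) = piStr 2 (chi 2 a) := by rw [Tstr, ht, piStr]
    rw [iota, hT, piStr_eq_blockJoin (by omega) (hSH 2 (by omega)).2,
      count_blockJoin fun i _ => notMem_rulerBlock 2 i, digits_chi le_rfl, Nat.ofDigits_digits]
  · rintro ⟨t, -, rfl⟩
    rw [piStr_eq_blockJoin (by omega) (hSH 2 (by omega)).2, ← Tstr_eq_blockJoin hSH le_rfl t]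
    exact curl_Tstr_le (hSH 1 le_rfl).2 t

/-- Theorem `iota1 characterization`. Let `m ≥ 1`, `a ≥ 1`, with
level-`m` expansion `a_{m+1},…,a_n`; let `t_l := ord_l(a_l)+1` be the position of the
first nonzero base-`l` digit of `a_l` and `u_l` (if it exists) that of the second. Then
`C(π^(m+1)(1,χ^(m+1)(a))) = 1` iff for all `m+1 ≤ l ≤ n`: `maxdigit_l(a_l) ≤ 1` and,
whenever `u_l` exists, `(ι_l(t_l), ι_l(u_l)) ∉ 𝒮_{l+1}`.  For `m = 1` this is moreover
equivalent to `a ∈ Im(ι_1)`. -/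
theorem statement6 (hSH : StandingHyp) (m a : ℕ) (hm : 1 ≤ m) (ha : 1 ≤ a) :
    (curl (piStr (m + 1) (chi (m + 1) a)) = 1 ↔
      ∀ l, m + 1 ≤ l → l ≤ levelEnd m a →
        maxdigit l (lexp m a l) ≤ 1 ∧
        ∀ u, IsSecondNonzero l (lexp m a l) u →
          (iota l (ordb l (lexp m a l) + 1), iota l u) ∉ Sset (l + 1)) ∧
    (m = 1 →
      (curl (piStr 2 (chi 2 a)) = 1 ↔ ∃ t : ℕ, 1 ≤ t ∧ iota 1 t = a)) := by
  have hone : ∀ S, curl S = 1 ↔ curl S ≤ 1 := fun S =>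
    ⟨fun h => h.le, fun h => le_antisymm h (one_le_curl S)⟩
  rw [hone, hone]
  exact ⟨curl_piStr_le_one_iff_forall hSH hm ha, fun _ => curl_piStr_two_iff hSH a⟩
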